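/- If f(z) = ∑_{k≥0} a_{2k+1} z^{2k+1} is odd, analytic and univalent (injective) in the unit disk 𝔻, with 0 < α = |a_1| ≤ 1, then ∑_{k≥0} |a_{2k+1}| r^{2k+1} ≤ 1 for all 0 ≤ r ≤ r_α, where r_α = (−α + √(4 + α²))/2. The bound is attained by the extremal function f(z) = α z/(1 − z²). -/

import Mathlib

section
open MeasureTheory Set

/-- crossing lemma on one side -/
lemma cross_one (h : ℝ → ℝ) (hl : LipschitzWith 1 h) (x0 x1 t' t : ℝ) (hx : x0 ≤ x1)
    (h0 : h x0 ≤ t') (h1 : t ≤ h x1) :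
    ENNReal.ofReal (t - t') ≤ volume (Ioc x0 x1 ∩ {x | t' < h x ∧ h x ≤ t}) := by
  set S := Ioc x0 x1 ∩ {x | t' < h x ∧ h x ≤ t}
  have hsub : Ioc t' t ⊆ h '' S := by
    intro y hy
    have : y ∈ h '' Icc x0 x1 := by
      apply intermediate_value_Icc hx hl.continuous.continuousOn
      exact ⟨h0.trans hy.1.le, hy.2.trans h1⟩
    obtain ⟨x, hx, rfl⟩ := this
    refine ⟨x, ⟨⟨lt_of_le_of_ne hx.1 ?_, hx.2⟩, hy.1, hy.2⟩, rfl⟩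
    rintro rfl
    exact absurd hy.1 (not_lt.mpr h0)
  have h2 : volume (h '' S) ≤ volume S := by
    have := (hl.lipschitzOnWith (s := S)).hausdorffMeasure_image_le (d := 1) (by norm_num)
    simpa [hausdorffMeasure_real] using this
  calc ENNReal.ofReal (t - t') = volume (Ioc t' t) := by simp
    _ ≤ _ := (measure_mono hsub).trans h2

lemma cross_one' (h : ℝ → ℝ) (hl : LipschitzWith 1 h) (x0 x1 t' t : ℝ) (hx : x0 ≤ x1)
    (h0 : t ≤ h x0) (h1 : h x1 ≤ t') :
    ENNReal.ofReal (t - t') ≤ volume (Ioc x0 x1 ∩ {x | t' < h x ∧ h x ≤ t}) := by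
  set S := Ioc x0 x1 ∩ {x | t' < h x ∧ h x ≤ t}
  have hsub : Ioo t' t ⊆ h '' S := by
    intro y hy
    have : y ∈ h '' Icc x0 x1 := by
      apply intermediate_value_Icc' hx hl.continuous.continuousOn
      exact ⟨h1.trans hy.1.le, hy.2.le.trans h0⟩
    obtain ⟨x, hx, rfl⟩ := this
    refine ⟨x, ⟨⟨lt_of_le_of_ne hx.1 ?_, hx.2⟩, hy.1, hy.2.le⟩, rfl⟩
    rintro rfl
    exact absurd hy.2 (not_lt.mpr h0)
  have h2 : volume (h '' S) ≤ volume S := by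
    have := (hl.lipschitzOnWith (s := S)).hausdorffMeasure_image_le (d := 1) (by norm_num)
    simpa [hausdorffMeasure_real] using this
  calc ENNReal.ofReal (t - t') = volume (Ioo t' t) := by simp
    _ ≤ _ := (measure_mono hsub).trans h2

/-- measure of periodic set over any period -/
lemma vol_periodic (S : Set ℝ) (hS : MeasurableSet S)
    (hp : ∀ x, x + 2 * Real.pi ∈ S ↔ x ∈ S) (a b : ℝ) :
    volume (Ioc a (a + 2 * Real.pi) ∩ S) = volume (Ioc b (b + 2 * Real.pi) ∩ S) := by
  have hpi : 0 < 2 * Real.pi := by positivity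
  have := (isAddFundamentalDomain_Ioc hpi a).setLIntegral_eq
    (isAddFundamentalDomain_Ioc hpi b) (S.indicator (fun _ => 1)) ?_
  · rw [lintegral_indicator hS, lintegral_indicator hS] at this
    simpa [Measure.restrict_restrict hS, inter_comm] using this
  · rintro ⟨g, hg⟩ x
    obtain ⟨n, rfl⟩ := AddSubgroup.mem_zmultiples_iff.1 hg
    have key : Function.Periodic (S.indicator (fun _ => (1 : ENNReal))) (2 * Real.pi) := by
      intro x
      by_cases hx : x ∈ S
      · rw [indicator_of_mem hx, indicator_of_mem ((hp x).2 hx)]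
      · rw [indicator_of_notMem hx, indicator_of_notMem (fun h => hx ((hp x).1 h))]
    have := (key.zsmul n) x
    rw [← this]
    congr 1
    simp [add_comm, AddSubmonoid.vadd_def, AddSubgroup.vadd_def]

lemma cross_two (h : ℝ → ℝ) (hl : LipschitzWith 1 h) (hp : Function.Periodic h (2 * Real.pi))
    (x0 x1 t' t : ℝ) (htt : t' ≤ t) (h0 : h x0 ≤ t') (h1 : t ≤ h x1) :
    2 * (t - t') ≤ volume.real (Ioc (-Real.pi) Real.pi ∩ {x | t' < h x ∧ h x ≤ t}) := by
  have hpi : 0 < 2 * Real.pi := by positivity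
  obtain ⟨x2, hx2, hx2'⟩ := hp.exists_mem_Ico hpi x1 x0
  set S := {x | t' < h x ∧ h x ≤ t}
  have hS : MeasurableSet S := by
    have := hl.continuous.measurable
    exact (measurableSet_lt measurable_const this).inter (measurableSet_le this measurable_const)
  have e1 := vol_periodic S hS (fun x => by simp [S, hp x]) (-Real.pi) x0
  have e2 : -Real.pi + 2 * Real.pi = Real.pi := by ring
  rw [e2] at e1
  have a1 := cross_one h hl x0 x2 t' t hx2.1 h0 (hx2' ▸ h1)
  have a2 := cross_one' h hl x2 (x0 + 2 * Real.pi) t' t hx2.2.le (hx2' ▸ h1) (by rw [hp]; exact h0)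
  have hu : Ioc x0 (x0 + 2 * Real.pi) ∩ S = (Ioc x0 x2 ∩ S) ∪ (Ioc x2 (x0 + 2 * Real.pi) ∩ S) := by
    rw [← union_inter_distrib_right, Ioc_union_Ioc_eq_Ioc hx2.1 hx2.2.le]
  have hd : Disjoint (Ioc x0 x2 ∩ S) (Ioc x2 (x0 + 2 * Real.pi) ∩ S) := by
    apply Disjoint.mono inter_subset_left inter_subset_left
    exact Ioc_disjoint_Ioc_of_le le_rfl
  rw [Measure.real, e1, hu, measure_union hd (measurableSet_Ioc.inter hS)]
  have hfin : ∀ a b, volume (Ioc a b ∩ S) ≠ ⊤ := fun a b =>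
    ((measure_mono inter_subset_left).trans_lt (by simp)).ne
  rw [ENNReal.toReal_add (hfin _ _) (hfin _ _)]
  have b1 := (ENNReal.ofReal_le_iff_le_toReal (hfin _ _)).1 a1
  have b2 := (ENNReal.ofReal_le_iff_le_toReal (hfin _ _)).1 a2
  linarith

end

section
open MeasureTheory Set

lemma layer (h q : ℝ → ℝ) (hh : Measurable h) (hq : Continuous q) (B : ℝ) (hB : 0 ≤ B)
    (h0 : ∀ x, 0 ≤ h x) (h1 : ∀ x, h x ≤ B) :
    ∫ x in (-Real.pi)..Real.pi, q x * h x
      = ∫ t in (0)..B, ∫ x in Ioc (-Real.pi) Real.pi ∩ {x | t < h x}, q x := by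
  have hpi : -Real.pi ≤ Real.pi := by linarith [Real.pi_pos]
  have hms : ∀ t, MeasurableSet {x | t < h x} := fun t => measurableSet_lt measurable_const hh
  have e1 : ∀ x, q x * h x = ∫ t in Ioc 0 B, (if t < h x then q x else 0) := by
    intro x
    have : (fun t => if t < h x then q x else 0) = (Iio (h x)).indicator (fun _ => q x) := by
      ext t; simp [indicator]
    rw [this, setIntegral_indicator measurableSet_Iio, setIntegral_const, smul_eq_mul, mul_comm]
    congr 1
    have : volume (Ioc 0 B ∩ Iio (h x)) = volume (Ioo 0 (h x)) := by
      apply measure_congr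
      have hne : ∀ᵐ t : ℝ, t ≠ B := by simp [ae_iff, measure_singleton]
      filter_upwards [hne] with t ht
      apply propext
      change (t ∈ Ioc 0 B ∩ Iio (h x)) ↔ t ∈ Ioo 0 (h x)
      simp only [mem_inter_iff, mem_Ioc, mem_Iio, mem_Ioo]
      constructor
      · rintro ⟨⟨a, b⟩, c⟩; exact ⟨a, c⟩
      · rintro ⟨a, c⟩; exact ⟨⟨a, (c.le.trans (h1 x))⟩, c⟩
    rw [Measure.real, this, Real.volume_Ioo, ENNReal.toReal_ofReal (by linarith [h0 x])]; ring
  rw [intervalIntegral.integral_of_le hpi, intervalIntegral.integral_of_le hB]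
  simp_rw [e1]
  rw [integral_integral_swap]
  · apply integral_congr_ae
    filter_upwards with t
    have : (fun x => if t < h x then q x else 0) = ({x | t < h x}).indicator q := by
      ext x; simp [indicator]
    rw [this, setIntegral_indicator (hms t)]
  · have hqi : Integrable q (volume.restrict (Ioc (-Real.pi) Real.pi)) :=
      (hq.integrableOn_Icc (a := -Real.pi) (b := Real.pi)).mono_set Ioc_subset_Icc_self
    have hd : Integrable (fun p : ℝ × ℝ => q p.1)
      ((volume.restrict (Ioc (-Real.pi) Real.pi)).prod (volume.restrict (Ioc 0 B))) :=
      hqi.comp_fst _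
    refine hd.mono ?_ ?_
    · apply Measurable.aestronglyMeasurable
      apply Measurable.ite
      · exact measurableSet_lt measurable_snd (hh.comp measurable_fst)
      · exact hq.measurable.comp measurable_fst
      · exact measurable_const
    · filter_upwards with p
      simp only [Function.uncurry]
      split_ifs <;> simp

lemma int_smooth (e : ℝ → ℝ) (hm : Measurable e) (h0 : ∀ x, 0 ≤ e x) (h1 : ∀ x, e x ≤ 1)
    (hp : Function.Periodic e (2 * Real.pi)) (A : ℝ) (hA : 0 ≤ A) :
    ∫ x in (-Real.pi)..Real.pi, (∫ y in (x - A)..(x + A), e y)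
      = 2 * A * ∫ x in (-Real.pi)..Real.pi, e x := by
  have hpi : -Real.pi ≤ Real.pi := by linarith [Real.pi_pos]
  have hAA : -A ≤ A := by linarith
  have e1 : ∀ x, ∫ y in (x - A)..(x + A), e y = ∫ y in (-A)..A, e (x + y) := by
    intro x
    rw [intervalIntegral.integral_comp_add_left (fun y => e y) x]; congr 1
  simp_rw [e1]
  have hs : ∫ x in (-Real.pi)..Real.pi, ∫ y in (-A)..A, e (x + y) =
      ∫ y in (-A)..A, ∫ x in (-Real.pi)..Real.pi, e (x + y) := by
    simp_rw [intervalIntegral.integral_of_le hpi, intervalIntegral.integral_of_le hAA]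
    apply integral_integral_swap
    apply Integrable.mono' (integrable_const (1 : ℝ))
    · exact (hm.comp (measurable_fst.add measurable_snd)).aestronglyMeasurable
    · filter_upwards with p
      simp only [Function.uncurry]
      rw [Real.norm_of_nonneg (h0 _)]; exact h1 _
  rw [hs]
  have : ∀ y, ∫ x in (-Real.pi)..Real.pi, e (x + y) = ∫ x in (-Real.pi)..Real.pi, e x := by
    intro y
    rw [intervalIntegral.integral_comp_add_right (fun x => e x) y]
    have := hp.intervalIntegral_add_eq (-Real.pi + y) (-Real.pi)
    convert this using 2 <;> ring
  simp_rw [this]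
  rw [intervalIntegral.integral_const, smul_eq_mul]; ring

lemma smooth_lip (e : ℝ → ℝ) (hm : Measurable e) (h0 : ∀ x, 0 ≤ e x) (h1 : ∀ x, e x ≤ 1)
    (A : ℝ) : LipschitzWith 1 (fun x => ∫ y in (x - A)..(x + A), e y) := by
  have hi : ∀ a b, IntervalIntegrable e volume a b := by
    intro a b
    refine IntervalIntegrable.mono_fun' (g := fun _ => 1) (by simp) hm.aestronglyMeasurable ?_
    filter_upwards with x
    rw [Real.norm_of_nonneg (h0 _)]; exact h1 _
  have key : ∀ x y, x ≤ y → |(∫ t in (x - A)..(x + A), e t) - ∫ t in (y - A)..(y + A), e t| ≤ y - x := by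
    intro x y hxy
    have e1 : (∫ t in (x - A)..(x + A), e t) - ∫ t in (y - A)..(y + A), e t
      = (∫ t in (x - A)..(y - A), e t) - ∫ t in (x + A)..(y + A), e t := by
      rw [intervalIntegral.integral_interval_sub_interval_comm (hi _ _) (hi _ _) (hi _ _)]
    have b : ∀ c, 0 ≤ (∫ t in (x + c)..(y + c), e t) ∧ (∫ t in (x + c)..(y + c), e t) ≤ y - x := by
      intro c
      refine ⟨intervalIntegral.integral_nonneg (by linarith) (fun t _ => h0 t), ?_⟩
      calc (∫ t in (x + c)..(y + c), e t) ≤ ∫ t in (x + c)..(y + c), (1 : ℝ) :=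
            intervalIntegral.integral_mono (by linarith) (hi _ _) (by simp) h1
        _ = _ := by simp
    have b1 := b (-A)
    have b2 := b A
    simp only [← sub_eq_add_neg] at b1
    rw [e1, abs_le]; constructor <;> linarith [b1.1, b1.2, b2.1, b2.2]
  apply LipschitzWith.of_dist_le_mul
  intro x y
  simp only [NNReal.coe_one, one_mul, Real.dist_eq]
  rcases le_total x y with h | h
  · rw [abs_sub_comm x y, abs_of_nonneg (sub_nonneg.2 h)]; exact key x y h
  · rw [abs_sub_comm, abs_of_nonneg (sub_nonneg.2 h)]; exact key y x h

end

section
open MeasureTheory Set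

lemma rearr (e : ℝ → ℝ) (hm : Measurable e) (h0 : ∀ x, 0 ≤ e x) (h1 : ∀ x, e x ≤ 1)
    (hp : Function.Periodic e (2 * Real.pi)) (θ A : ℝ) (hA : 0 < A) (hAθ : A < θ)
    (hθA : θ + A ≤ Real.pi) (hint : ∫ x in (-Real.pi)..Real.pi, e x = 2 * θ)
    (q : ℝ → ℝ) (hq : Continuous q) (w : ℝ → ℝ) (hwc : Continuous w)
    (hw : ∀ G : Set ℝ, MeasurableSet G → ∫ x in Ioc (-Real.pi) Real.pi ∩ G, q x ≤
      w (volume.real (Ioc (-Real.pi) Real.pi ∩ G) / 2))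
    (hsup : ∀ y ∈ Icc 0 Real.pi, ∃ c, (∀ a b, y ≤ a → a ≤ b → b ≤ Real.pi → w b - w a ≤ c * (b - a)) ∧
      (∀ a b, 0 ≤ a → a ≤ b → b ≤ y → c * (b - a) ≤ w b - w a)) :
    ∫ x in (-Real.pi)..Real.pi, q x * (∫ y in (x - A)..(x + A), e y)
      ≤ ∫ α in (-A)..A, w (θ + α) := by
  have hpi : -Real.pi ≤ Real.pi := by linarith [Real.pi_pos]
  set h : ℝ → ℝ := fun x => ∫ y in (x - A)..(x + A), e y with hh
  have hl : LipschitzWith 1 h := smooth_lip e hm h0 h1 A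
  have hi : ∀ a b, IntervalIntegrable e volume a b := by
    intro a b
    refine IntervalIntegrable.mono_fun' (g := fun _ => 1) (by simp) hm.aestronglyMeasurable ?_
    filter_upwards with x
    rw [Real.norm_of_nonneg (h0 _)]; exact h1 _
  have hh0 : ∀ x, 0 ≤ h x := fun x =>
    intervalIntegral.integral_nonneg (by linarith) (fun t _ => h0 t)
  have hh1 : ∀ x, h x ≤ 2 * A := by
    intro x
    calc h x ≤ ∫ t in (x - A)..(x + A), (1 : ℝ) :=
            intervalIntegral.integral_mono (by linarith) (hi _ _) (by simp) h1
        _ = _ := by simp; ring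
  have hhp : Function.Periodic h (2 * Real.pi) := by
    intro x
    simp only [hh]
    have := intervalIntegral.integral_comp_add_right (a := x - A) (b := x + A) (fun y => e y) (2 * Real.pi)
    rw [show x + 2 * Real.pi - A = x - A + 2 * Real.pi by ring,
      show x + 2 * Real.pi + A = x + A + 2 * Real.pi by ring, ← this]
    congr 1; ext y; exact hp y
  have hB : 0 ≤ 2 * A := by linarith
  have hmh : Measurable h := hl.continuous.measurable
  set l : ℝ → ℝ := fun t => volume.real (Ioc (-Real.pi) Real.pi ∩ {x | t < h x}) with hl_def
  have hms : ∀ t, MeasurableSet {x | t < h x} := fun t => measurableSet_lt measurable_const hmh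
  have hfin : ∀ S, volume (Ioc (-Real.pi) Real.pi ∩ S) ≠ ⊤ := fun S =>
    ((measure_mono inter_subset_left).trans_lt (by simp)).ne
  have hlanti : Antitone l := by
    intro s t hst
    apply measureReal_mono _ (hfin _)
    apply inter_subset_inter_right
    intro x hx; exact lt_of_le_of_lt hst hx
  have hl0 : ∀ t, 0 ≤ l t := fun t => measureReal_nonneg
  have hl2 : ∀ t, l t ≤ 2 * Real.pi := by
    intro t
    calc l t ≤ volume.real (Ioc (-Real.pi) Real.pi) := measureReal_mono inter_subset_left (by simp)
      _ = _ := by rw [Real.volume_real_Ioc_of_le hpi]; ring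
  rw [layer h q hmh hq (2 * A) hB hh0 hh1]
  -- total of l
  have htot : ∫ t in (0)..(2 * A), l t = 4 * A * θ := by
    have := layer h (fun _ => 1) hmh continuous_const (2 * A) hB hh0 hh1
    simp only [one_mul, setIntegral_const, smul_eq_mul, mul_one] at this
    rw [hl_def, ← this, int_smooth e hm h0 h1 hp A hA.le, hint]; ring
  -- single crossing
  have hcr : ∀ t' t, 0 ≤ t' → t' < t → t ≤ 2 * A → 2 * (θ + A - t) ≤ l t → 2 * (θ + A - t') ≤ l t' := by
    intro t' t ht' htt ht hlt
    by_cases c1 : ∃ x, h x ≤ t'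
    · obtain ⟨x0, hx0⟩ := c1
      by_cases c2 : ∃ x, t ≤ h x
      · obtain ⟨x1, hx1⟩ := c2
        have hc := cross_two h hl hhp x0 x1 t' t htt.le hx0 hx1
        have hu : l t' = volume.real (Ioc (-Real.pi) Real.pi ∩ {x | t' < h x ∧ h x ≤ t}) + l t := by
          rw [hl_def]
          simp only
          rw [← measureReal_union _ (measurableSet_Ioc.inter (hms t)) (hfin _) (hfin _)]
          · congr 1; ext x
            simp only [mem_inter_iff, mem_setOf_eq, mem_union]
            constructor
            · rintro ⟨a, b⟩
              rcases le_or_gt (h x) t with c | c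
              · exact Or.inl ⟨a, b, c⟩
              · exact Or.inr ⟨a, c⟩
            · rintro (⟨a, b, c⟩ | ⟨a, b⟩)
              · exact ⟨a, b⟩
              · exact ⟨a, htt.trans b⟩
          · rw [Set.disjoint_left]
            rintro x ⟨_, _, a⟩ ⟨_, b⟩
            exact absurd b (not_lt.2 a)
        linarith
      · push Not at c2
        have : l t = 0 := by
          have : {x | t < h x} = ∅ := by
            ext x; simp [(c2 x).le]
          simp [hl_def, this]
        linarith
    · push Not at c1
      have : l t' = 2 * Real.pi := by
        have : {x | t' < h x} = univ := by
          ext x; simp [c1 x]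
        simp only [hl_def, this, inter_univ]
        rw [Real.volume_real_Ioc_of_le hpi]; ring
      linarith
  obtain ⟨ts, hts, hts1, hts2⟩ : ∃ ts ∈ Icc 0 (2 * A), (∀ t ∈ Icc 0 (2 * A), t < ts → 2 * (θ + A - t) ≤ l t) ∧
      (∀ t ∈ Icc 0 (2 * A), ts < t → l t ≤ 2 * (θ + A - t)) := by
    set T := {t | t ∈ Icc 0 (2 * A) ∧ 2 * (θ + A - t) ≤ l t}
    by_cases hT : T.Nonempty
    · have hbd : BddAbove T := ⟨2 * A, fun t ht => ht.1.2⟩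
      obtain ⟨t0, ht0⟩ := hT
      refine ⟨sSup T, ⟨ht0.1.1.trans (le_csSup hbd ht0), csSup_le ⟨t0, ht0⟩ (fun t ht => ht.1.2)⟩, ?_, ?_⟩
      · intro t ht hlt
        obtain ⟨t1, ht1, hlt1⟩ := exists_lt_of_lt_csSup ⟨t0, ht0⟩ hlt
        exact hcr t t1 ht.1 hlt1 ht1.1.2 ht1.2
      · intro t ht hlt
        by_contra hcon
        exact absurd (le_csSup hbd ⟨ht, (not_le.1 hcon).le⟩) (not_le.2 hlt)
    · refine ⟨0, ⟨le_rfl, hB⟩, fun t ht h => absurd h (not_lt.2 ht.1), ?_⟩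
      intro t ht _
      by_contra hcon
      exact hT ⟨t, ht, (not_le.1 hcon).le⟩
  obtain ⟨c, hc1, hc2⟩ := hsup (θ + A - ts) ⟨by linarith [hts.2], by linarith [hts.1]⟩
  have hptw : ∀ t ∈ Icc 0 (2 * A), t ≠ ts → w (l t / 2) ≤ w (θ + A - t) + c * (l t / 2 - (θ + A - t)) := by
    intro t ht hne
    rcases lt_or_gt_of_ne hne with hlt | hlt
    · have := hc1 (θ + A - t) (l t / 2) (by linarith) (by linarith [hts1 t ht hlt]) (by linarith [hl2 t])
      linarith
    · have := hc2 (l t / 2) (θ + A - t) (by linarith [hl0 t]) (by linarith [hts2 t ht hlt]) (by linarith)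
      linarith
  have hli : IntervalIntegrable l volume 0 (2 * A) := hlanti.intervalIntegrable
  have hqi : Integrable q (volume.restrict (Ioc (-Real.pi) Real.pi)) :=
      (hq.integrableOn_Icc (a := -Real.pi) (b := Real.pi)).mono_set Ioc_subset_Icc_self
  have hwl : IntervalIntegrable (fun t => w (θ + A - t) + c * (l t / 2 - (θ + A - t))) volume 0 (2 * A) := by
    apply IntervalIntegrable.add
    · exact (hwc.comp (by fun_prop)).intervalIntegrable _ _
    · apply IntervalIntegrable.const_mul
      apply IntervalIntegrable.sub (hli.div_const 2)
      exact Continuous.intervalIntegrable (by fun_prop) _ _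
  have hLI : IntervalIntegrable (fun t => ∫ x in Ioc (-Real.pi) Real.pi ∩ {x | t < h x}, q x) volume 0 (2 * A) := by
    have hG : Measurable (Function.uncurry (fun (t x : ℝ) => if t < h x then q x else 0)) := by
      apply Measurable.ite
      · exact measurableSet_lt measurable_fst (hmh.comp measurable_snd)
      · exact hq.measurable.comp measurable_snd
      · exact measurable_const
    have e1 : (fun t => ∫ x in Ioc (-Real.pi) Real.pi ∩ {x | t < h x}, q x) =
        fun t => ∫ x in Ioc (-Real.pi) Real.pi, (if t < h x then q x else 0) := by
      ext t
      have : (fun x => if t < h x then q x else 0) = ({x | t < h x}).indicator q := by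
        ext x; simp [indicator]
      rw [this, setIntegral_indicator (hms t)]
    have hmm : StronglyMeasurable (fun t => ∫ x in Ioc (-Real.pi) Real.pi, (if t < h x then q x else 0)) :=
      hG.stronglyMeasurable.integral_prod_right
    refine IntervalIntegrable.mono_fun' (g := fun _ => ∫ x in Ioc (-Real.pi) Real.pi, ‖q x‖) (by simp) ?_ ?_
    · rw [e1]; exact hmm.aestronglyMeasurable
    · filter_upwards with t
      refine (norm_integral_le_integral_norm _).trans ?_
      apply setIntegral_mono_set hqi.norm
      · filter_upwards with x; exact norm_nonneg _
      · exact inter_subset_left.eventuallyLE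
  calc ∫ t in (0)..(2 * A), ∫ x in Ioc (-Real.pi) Real.pi ∩ {x | t < h x}, q x
      ≤ ∫ t in (0)..(2 * A), (w (θ + A - t) + c * (l t / 2 - (θ + A - t))) := by
        apply intervalIntegral.integral_mono_ae_restrict hB hLI hwl
        have hne : ∀ᵐ t : ℝ, t ≠ ts := by simp [ae_iff, measure_singleton]
        filter_upwards [ae_restrict_mem measurableSet_Icc, ae_restrict_of_ae hne] with t ht hnet
        exact (hw _ (hms t)).trans (hptw t ht hnet)
    _ = (∫ t in (0)..(2 * A), w (θ + A - t)) + c * ((∫ t in (0)..(2 * A), l t) / 2 - ∫ t in (0)..(2 * A), (θ + A - t)) := by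
        rw [intervalIntegral.integral_add, intervalIntegral.integral_const_mul, intervalIntegral.integral_sub,
          intervalIntegral.integral_div]
        · exact hli.div_const 2
        · exact Continuous.intervalIntegrable (by fun_prop) _ _
        · exact (hwc.comp (by fun_prop)).intervalIntegrable _ _
        · apply IntervalIntegrable.const_mul
          apply IntervalIntegrable.sub (hli.div_const 2)
          exact Continuous.intervalIntegrable (by fun_prop) _ _
    _ = ∫ t in (0)..(2 * A), w (θ + A - t) := by
        rw [htot]
        have : ∫ t in (0)..(2 * A), (θ + A - t) = 2 * A * θ := by
          rw [intervalIntegral.integral_sub (by simp) (by simp)]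
          simp; ring
        rw [this]; ring
    _ = ∫ α in (-A)..A, w (θ + α) := by
        rw [intervalIntegral.integral_comp_sub_left (fun t => w t) (θ + A),
          intervalIntegral.integral_comp_add_left (fun t => w t) θ]
        congr 1 <;> ring

end

section
open MeasureTheory Set

lemma disc_avg (u : ℂ → ℝ) (hu : Continuous u) (ζ : ℂ) (ρ : ℝ) (hρ : 0 < ρ) :
    ∫ s in (-ρ)..ρ, ∫ α in (-√(ρ^2 - s^2))..√(ρ^2 - s^2), u (ζ + s + α * Complex.I)
      = ∫ t in (0:ℝ)..ρ, 2 * Real.pi * t * Real.circleAverage u ζ t := by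
  have hpi := Real.pi_pos
  let h : ℝ × ℝ → ℝ := fun p => u (ζ + p.1 + p.2 * Complex.I)
  have hc : Continuous h := by fun_prop
  let S : Set (ℝ × ℝ) := {p | p.1^2 + p.2^2 < ρ^2}
  have hS : MeasurableSet S := by
    apply measurableSet_lt <;> fun_prop
  have hSi : IntegrableOn h S := by
    refine IntegrableOn.mono_set (hc.continuousOn.integrableOn_compact (isCompact_Icc (a := ((-ρ, -ρ) : ℝ × ℝ)) (b := (ρ, ρ)))) ?_
    intro p hp
    have hp' : p.1^2 + p.2^2 < ρ^2 := hp
    have h1 := abs_le.1 (abs_le_of_sq_le_sq (by nlinarith [sq_nonneg p.2] : p.1^2 ≤ ρ^2) hρ.le)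
    have h2 := abs_le.1 (abs_le_of_sq_le_sq (by nlinarith [sq_nonneg p.1] : p.2^2 ≤ ρ^2) hρ.le)
    exact ⟨⟨h1.1, h2.1⟩, ⟨h1.2, h2.2⟩⟩
  have key := integral_comp_polarCoord_symm (S.indicator h)
  have hR : ∫ p, S.indicator h p = ∫ s in (-ρ)..ρ, ∫ α in (-√(ρ^2 - s^2))..√(ρ^2 - s^2), u (ζ + s + α * Complex.I) := by
    rw [Measure.volume_eq_prod, integral_prod _ (by rw [← Measure.volume_eq_prod]; exact hSi.integrable_indicator hS)]
    rw [intervalIntegral.integral_of_le (by linarith), ← integral_Ioc_eq_integral_Ioo.symm,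
      ← integral_indicator measurableSet_Ioo]
    congr 1; ext x
    by_cases hx : x ∈ Ioo (-ρ) ρ
    · rw [indicator_of_mem hx, intervalIntegral.integral_of_le (by linarith [Real.sqrt_nonneg (ρ^2 - x^2)]), integral_Ioc_eq_integral_Ioo, ← integral_indicator measurableSet_Ioo]
      congr 1; ext y
      have : (x, y) ∈ S ↔ y ∈ Ioo (-√(ρ^2 - x^2)) √(ρ^2 - x^2) := by
        rw [mem_Ioo, ← abs_lt, Real.lt_sqrt (abs_nonneg _), sq_abs]
        show x^2 + y^2 < ρ^2 ↔ _
        constructor <;> intro h <;> linarith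
      by_cases hy : (x, y) ∈ S
      · rw [indicator_of_mem hy, indicator_of_mem (this.1 hy)]
      · rw [indicator_of_notMem hy, indicator_of_notMem (fun h => hy (this.2 h))]
    · rw [indicator_of_notMem hx]
      rw [integral_eq_zero_of_ae]
      filter_upwards with y
      apply indicator_of_notMem
      intro hxy
      apply hx
      have hp' : x^2 + y^2 < ρ^2 := hxy
      exact abs_lt.1 (abs_lt_of_sq_lt_sq (by nlinarith [sq_nonneg y] : x^2 < ρ^2) hρ.le)
  rw [← hR, ← key]
  have e1 : ∫ p in polarCoord.target, p.1 • S.indicator h (polarCoord.symm p)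
      = ∫ p in (Ioo 0 ρ ×ˢ Ioo (-Real.pi) Real.pi), p.1 * u (circleMap ζ p.1 p.2) := by
    rw [← integral_indicator (measurableSet_Ioo.prod measurableSet_Ioo), ← integral_indicator polarCoord.open_target.measurableSet]
    congr 1; ext ⟨r, t⟩
    have ht : (r, t) ∈ polarCoord.target ↔ 0 < r ∧ t ∈ Ioo (-Real.pi) Real.pi := Iff.rfl
    have hs : polarCoord.symm (r, t) ∈ S ↔ r^2 < ρ^2 := by
      show (r * Real.cos t)^2 + (r * Real.sin t)^2 < ρ^2 ↔ _
      rw [show (r * Real.cos t)^2 + (r * Real.sin t)^2 = r^2 * (Real.sin t^2 + Real.cos t^2) by ring, Real.sin_sq_add_cos_sq, mul_one]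
    by_cases h1 : (r, t) ∈ polarCoord.target
    · rw [indicator_of_mem h1]
      have h1' := ht.1 h1
      by_cases h2 : r < ρ
      · rw [indicator_of_mem (show (r,t) ∈ (Ioo 0 ρ ×ˢ Ioo (-Real.pi) Real.pi) from ⟨⟨h1'.1, h2⟩, h1'.2⟩),
          indicator_of_mem (hs.2 (by nlinarith))]
        simp only [smul_eq_mul, h, polarCoord_symm_apply, circleMap]
        congr 2
        rw [Complex.exp_mul_I]; push_cast; ring
      · rw [indicator_of_notMem (show (r,t) ∉ (Ioo 0 ρ ×ˢ Ioo (-Real.pi) Real.pi) from fun h => h2 h.1.2),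
          indicator_of_notMem (fun h => h2 (lt_of_pow_lt_pow_left₀ 2 hρ.le (hs.1 h))), smul_zero]
    · rw [indicator_of_notMem h1, indicator_of_notMem (fun h => h1 ⟨h.1.1, h.2⟩)]
  rw [e1, Measure.volume_eq_prod, setIntegral_prod, intervalIntegral.integral_of_le hρ.le, integral_Ioc_eq_integral_Ioo]
  · refine setIntegral_congr_fun measurableSet_Ioo fun t ht => ?_
    simp only
    rw [Real.circleAverage_eq_integral_add (-Real.pi), intervalIntegral.integral_comp_add_right (fun θ => u (circleMap ζ t θ))]
    rw [integral_const_mul, intervalIntegral.integral_of_le (by linarith), integral_Ioc_eq_integral_Ioo, smul_eq_mul]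
    rw [show 2 * Real.pi + -Real.pi = Real.pi by ring, zero_add]
    field_simp
  · rw [← Measure.volume_eq_prod]
    refine IntegrableOn.mono_set (Continuous.continuousOn ?_ |>.integrableOn_compact ((isCompact_Icc (a := (0:ℝ)) (b := ρ)).prod (isCompact_Icc (a := -Real.pi) (b := Real.pi)))) (prod_mono Ioo_subset_Icc_self Ioo_subset_Icc_self)
    unfold circleMap
    fun_prop

lemma disc_submean (u : ℂ → ℝ) (hu : Continuous u) (ζ : ℂ) (ρ : ℝ) (hρ : 0 < ρ)
    (h : ∀ t ∈ Ioc 0 ρ, u ζ ≤ Real.circleAverage u ζ t) :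
    Real.pi * ρ^2 * u ζ ≤ ∫ s in (-ρ)..ρ, ∫ α in (-√(ρ^2 - s^2))..√(ρ^2 - s^2), u (ζ + s + α * Complex.I) := by
  have hpi := Real.pi_pos
  rw [disc_avg u hu ζ ρ hρ]
  have : Real.pi * ρ^2 * u ζ = ∫ t in (0:ℝ)..ρ, 2 * Real.pi * t * u ζ := by
    rw [intervalIntegral.integral_mul_const, intervalIntegral.integral_const_mul, integral_id]; ring
  rw [this]
  have hca : Continuous (fun t => Real.circleAverage u ζ t) := by fun_prop
  refine intervalIntegral.integral_mono_on_of_le_Ioo hρ.le (Continuous.intervalIntegrable (by fun_prop) _ _) (Continuous.intervalIntegrable (by fun_prop) _ _) fun t ht => ?_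
  have := h t ⟨ht.1, ht.2.le⟩
  have := ht.1
  gcongr

lemma disc_mean (u : ℂ → ℝ) (hu : Continuous u) (ζ : ℂ) (ρ : ℝ) (hρ : 0 < ρ)
    (h : ∀ t ∈ Ioc 0 ρ, Real.circleAverage u ζ t = u ζ) :
    ∫ s in (-ρ)..ρ, ∫ α in (-√(ρ^2 - s^2))..√(ρ^2 - s^2), u (ζ + s + α * Complex.I) = Real.pi * ρ^2 * u ζ := by
  refine le_antisymm ?_ (disc_submean u hu ζ ρ hρ fun t ht => (h t ht).ge)
  have := disc_submean (fun z => - u z) hu.neg ζ ρ hρ (fun t ht => by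
    rw [← h t ht]; simp [Real.circleAverage_def])
  simp only [intervalIntegral.integral_neg] at this
  linarith

end

section
open MeasureTheory Set

lemma pint_cont {X : Type*} [TopologicalSpace X] [FirstCountableTopology X] [LocallyCompactSpace X] (f : X → ℝ → ℝ) (hf : Continuous f.uncurry) (a b : X → ℝ)
    (ha : Continuous a) (hb : Continuous b) : Continuous fun x => ∫ t in (a x)..(b x), f x t := by
  have : (fun x => ∫ t in (a x)..(b x), f x t) = fun x => (∫ t in (0:ℝ)..(b x), f x t) - ∫ t in (0:ℝ)..(a x), f x t := by
    ext x
    have hc : Continuous (f x) := by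
      have : f x = f.uncurry ∘ (fun t => (x, t)) := rfl
      rw [this]; fun_prop
    rw [intervalIntegral.integral_interval_sub_left (hc.intervalIntegrable _ _) (hc.intervalIntegrable _ _)]
  rw [this]
  exact (intervalIntegral.continuous_parametric_intervalIntegral_of_continuous hf hb).sub (intervalIntegral.continuous_parametric_intervalIntegral_of_continuous hf ha)

lemma swap_int (F : ℝ → ℝ → ℝ) (hF : Continuous F.uncurry) (a b c d : ℝ) :
    ∫ x in a..b, ∫ y in c..d, F x y = ∫ y in c..d, ∫ x in a..b, F x y := by
  apply intervalIntegral_intervalIntegral_swap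
  exact (hF.continuousOn.integrableOn_compact (isCompact_uIcc.prod isCompact_uIcc)).mono_set (prod_mono uIoc_subset_uIcc uIoc_subset_uIcc)

noncomputable def NN (u : ℂ → ℝ) (c s : ℝ) : ℝ := ∫ φ in (-Real.pi)..Real.pi, max (u (s + φ * Complex.I) - c) 0
noncomputable def SS (u : ℂ → ℝ) (p : ℝ × ℝ) : ℝ := ⨅ c : NNReal, (NN u c p.1 + 2 * c * p.2)

lemma NN_nonneg (u : ℂ → ℝ) (c s : ℝ) : 0 ≤ NN u c s :=
  intervalIntegral.integral_nonneg (by linarith [Real.pi_pos]) fun x _ => le_max_right _ _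

lemma NN_cont (u : ℂ → ℝ) (hu : Continuous u) (c : ℝ) : Continuous (NN u c) := by
  unfold NN
  apply pint_cont _ _ _ _ continuous_const continuous_const
  simp only [Function.uncurry_def]; fun_prop

lemma SS_bdd (u : ℂ → ℝ) (p : ℝ × ℝ) (hp : 0 ≤ p.2) : BddBelow (range fun c : NNReal => NN u c p.1 + 2 * c * p.2) := by
  refine ⟨0, ?_⟩
  rintro _ ⟨c, rfl⟩
  have := NN_nonneg u c p.1
  positivity

lemma SS_le (u : ℂ → ℝ) (s θ : ℝ) (hp : 0 ≤ θ) (c : ℝ) (hc : 0 ≤ c) : SS u (s, θ) ≤ NN u c s + 2 * c * θ :=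
  ciInf_le (SS_bdd u (s, θ) hp) ⟨c, hc⟩

lemma SS_usc (u : ℂ → ℝ) (hu : Continuous u) (K : Set (ℝ × ℝ)) (hK : ∀ p ∈ K, 0 ≤ p.2) :
    UpperSemicontinuousOn (SS u) K := by
  apply upperSemicontinuousOn_ciInf (fun p hp => SS_bdd u p (hK p hp))
  intro c
  apply ContinuousOn.upperSemicontinuousOn
  apply Continuous.continuousOn
  have := NN_cont u hu c
  fun_prop

lemma le_SS (u : ℂ → ℝ) (hu : Continuous u) (s : ℝ) (e : ℝ → ℝ) (hm : Measurable e) (h0 : ∀ x, 0 ≤ e x) (h1 : ∀ x, e x ≤ 1)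
    : ∫ φ in (-Real.pi)..Real.pi, e φ * u (s + φ * Complex.I) ≤ SS u (s, (∫ φ in (-Real.pi)..Real.pi, e φ) / 2) := by
  apply le_ciInf
  intro c
  have hei : IntervalIntegrable e volume (-Real.pi) Real.pi := by
    refine IntervalIntegrable.mono_fun' (g := fun _ => 1) (by simp) hm.aestronglyMeasurable ?_
    exact Filter.Eventually.of_forall fun x => by show ‖e x‖ ≤ 1; rw [Real.norm_of_nonneg (h0 x)]; exact h1 x
  have hq : Continuous (fun φ : ℝ => u (s + φ * Complex.I)) := by fun_prop
  have : NN u c s + 2 * c * ((∫ φ in (-Real.pi)..Real.pi, e φ) / 2) = ∫ φ in (-Real.pi)..Real.pi, (max (u (s + φ * Complex.I) - c) 0 + c * e φ) := by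
    rw [intervalIntegral.integral_add (Continuous.intervalIntegrable (by fun_prop) _ _) (hei.const_mul _), intervalIntegral.integral_const_mul, NN]; ring
  simp only [this]
  refine intervalIntegral.integral_mono_on (by linarith [Real.pi_pos]) (hei.mul_continuousOn hq.continuousOn) ((Continuous.intervalIntegrable (by fun_prop) _ _).add (hei.const_mul _)) fun x _ => ?_
  have a1 := h0 x; have a2 := h1 x
  have : e x * (u (s + x * Complex.I) - c) ≤ max (u (s + x * Complex.I) - c) 0 := by
    rcases le_total (u (s + x * Complex.I) - c) 0 with h | h
    · rw [max_eq_right h]; nlinarith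
    · rw [max_eq_left h]; nlinarith
  nlinarith

lemma SS_attain (u : ℂ → ℝ) (hu : Continuous u) (hu0 : ∀ z, 0 ≤ u z)
   (hp : ∀ z, u (z + 2 * Real.pi * Complex.I) = u z) (s θ : ℝ) (hθ0 : 0 ≤ θ) (hθ : θ ≤ Real.pi) (δ : ℝ) (hδ : 0 < δ) :
    ∃ e : ℝ → ℝ, Continuous e ∧ (∀ x, 0 ≤ e x) ∧ (∀ x, e x ≤ 1) ∧ Function.Periodic e (2 * Real.pi) ∧
      ∫ φ in (-Real.pi)..Real.pi, e φ = 2 * θ ∧ SS u (s, θ) - 2 * Real.pi * δ ≤ ∫ φ in (-Real.pi)..Real.pi, e φ * u (s + φ * Complex.I) := by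
  have hpi := Real.pi_pos
  set q : ℝ → ℝ := fun φ : ℝ => u (s + φ * Complex.I) with hqd
  have hq : Continuous q := by fun_prop
  let E : ℝ → ℝ → ℝ := fun c x => max 0 (min 1 ((q x - c) / δ))
  have hE : Continuous (E.uncurry) := by simp only [E, Function.uncurry_def]; fun_prop
  have hI : Continuous fun c => ∫ φ in (-Real.pi)..Real.pi, E c φ := pint_cont _ hE _ _ continuous_const continuous_const
  obtain ⟨M, hM⟩ := isCompact_Icc.exists_bound_of_continuousOn (hq.continuousOn (s := Icc (-Real.pi) Real.pi))
  have hM0 : 0 ≤ M := le_trans (norm_nonneg _) (hM 0 ⟨by linarith, by linarith⟩)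
  have hl : ∫ φ in (-Real.pi)..Real.pi, E (-δ) φ = 2 * Real.pi := by
    have : ∀ φ, E (-δ) φ = 1 := by
      intro φ
      have : 1 ≤ (q φ - -δ) / δ := by
        rw [le_div_iff₀ hδ]; linarith [hu0 (s + φ * Complex.I)]
      simp only [E, min_eq_left this]; simp
    simp [this]; ring
  have hr : ∫ φ in (-Real.pi)..Real.pi, E M φ = 0 := by
    rw [intervalIntegral.integral_congr (g := fun _ => 0)]; · simp
    intro φ hφ
    rw [uIcc_of_le (by linarith)] at hφ
    have h2 : (q φ - M) / δ ≤ 0 := div_nonpos_of_nonpos_of_nonneg (by linarith [le_abs_self (q φ), hM φ hφ, Real.norm_eq_abs (q φ)]) hδ.le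
    simp only [E]
    exact max_eq_left (le_trans (min_le_right _ _) h2)
  obtain ⟨c, hc, hcI⟩ := intermediate_value_Icc' (by linarith : -δ ≤ M) hI.continuousOn (show 2 * θ ∈ Icc _ _ by rw [hl, hr]; constructor <;> linarith)
  replace hcI : ∫ φ in (-Real.pi)..Real.pi, E c φ = 2 * θ := hcI
  have hEc : Continuous (E c) := by simp only [E]; fun_prop
  refine ⟨E c, hEc, fun x => le_max_left _ _, fun x => max_le zero_le_one (min_le_left _ _), ?_, hcI, ?_⟩
  · intro x
    have : q (x + 2 * Real.pi) = q x := by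
      simp only [hqd]; rw [← hp (s + x * Complex.I)]; congr 1; push_cast; ring
    simp only [E, this]
  · have h1 := SS_le u s θ hθ0 (c + δ) (by linarith [hc.1])
    have h2 : NN u (c + δ) s + 2 * (c + δ) * θ - 2 * Real.pi * δ = ∫ φ in (-Real.pi)..Real.pi, (max (q φ - (c + δ)) 0 + (c + δ) * E c φ - δ) := by
      rw [intervalIntegral.integral_sub (Continuous.intervalIntegrable (by fun_prop) _ _) (Continuous.intervalIntegrable (by fun_prop) _ _), intervalIntegral.integral_add (Continuous.intervalIntegrable (by fun_prop) _ _) (Continuous.intervalIntegrable (by fun_prop) _ _), intervalIntegral.integral_const_mul, NN, hcI]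
      simp; ring
    refine le_trans (by linarith : _ ≤ NN u (c + δ) s + 2 * (c + δ) * θ - 2 * Real.pi * δ) ?_
    rw [h2]
    refine intervalIntegral.integral_mono_on (by linarith) (Continuous.intervalIntegrable (by fun_prop) _ _) (Continuous.intervalIntegrable (by fun_prop) _ _) fun x _ => ?_
    show max (q x - (c + δ)) 0 + (c + δ) * E c x - δ ≤ E c x * q x
    rcases le_total (q x) c with h | h
    · have : E c x = 0 := max_eq_left (le_trans (min_le_right _ _) (div_nonpos_of_nonpos_of_nonneg (by linarith) hδ.le))
      rw [this, max_eq_right (by linarith)]; linarith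
    rcases le_total (q x) (c + δ) with h' | h'
    · rw [max_eq_right (by linarith)]
      have e0 : 0 ≤ E c x := le_max_left _ _
      have e1 : E c x ≤ 1 := max_le zero_le_one (min_le_left _ _)
      nlinarith
    · have : 1 ≤ (q x - c) / δ := by rw [le_div_iff₀ hδ]; linarith
      have : E c x = 1 := by simp [E, min_eq_left this]
      rw [this, max_eq_left (by linarith)]; linarith

end

section
open MeasureTheory Set

lemma swap_disc (G : ℝ → ℝ → ℝ → ℝ) (hG : Continuous (fun p : ℝ × ℝ × ℝ => G p.1 p.2.1 p.2.2)) (a b ρ : ℝ) :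
    ∫ φ in a..b, ∫ s in (-ρ)..ρ, ∫ α in (-√(ρ^2 - s^2))..√(ρ^2 - s^2), G φ s α
     = ∫ s in (-ρ)..ρ, ∫ α in (-√(ρ^2 - s^2))..√(ρ^2 - s^2), ∫ φ in a..b, G φ s α := by
  rw [swap_int (fun φ s => ∫ α in (-√(ρ^2 - s^2))..√(ρ^2 - s^2), G φ s α)]
  · congr 1; ext s
    rw [swap_int (fun φ α => G φ s α)]
    simp only [Function.uncurry_def]
    exact hG.comp (by fun_prop : Continuous fun p : ℝ × ℝ => (p.1, s, p.2))
  · simp only [Function.uncurry_def]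
    apply pint_cont (fun (x : ℝ × ℝ) α => G x.1 x.2 α)
    · exact hG.comp (by fun_prop : Continuous fun p : (ℝ × ℝ) × ℝ => (p.1.1, p.1.2, p.2))
    · fun_prop
    · fun_prop

noncomputable def vst (v : ℂ → ℝ) (s θ : ℝ) : ℝ := ∫ φ in (-θ)..θ, v (s + φ * Complex.I)

lemma vst_cont (v : ℂ → ℝ) (hv : Continuous v) : Continuous fun p : ℝ × ℝ => vst v p.1 p.2 := by
  unfold vst
  apply pint_cont (fun (x : ℝ × ℝ) (φ : ℝ) => v (x.1 + φ * Complex.I))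
  · simp only [Function.uncurry_def]; fun_prop
  · fun_prop
  · fun_prop

lemma vst_shift (v : ℂ → ℝ) (hv : Continuous v) (hev : ∀ s φ : ℝ, v (s + (-φ : ℝ) * Complex.I) = v (s + φ * Complex.I)) (s θ A : ℝ) :
    ∫ α in (-A)..A, vst v s (θ + α) = ∫ α in (-A)..A, ∫ φ in (-θ)..θ, v (s + (φ + α : ℝ) * Complex.I) := by
  set q : ℝ → ℝ := fun φ => v (s + φ * Complex.I) with hq
  have hqc : Continuous q := by fun_prop
  let V : ℝ → ℝ := fun x => ∫ φ in (0:ℝ)..x, q φ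
  have hVc : Continuous V := intervalIntegral.continuous_primitive (fun a b => hqc.intervalIntegrable a b) 0
  have hVo : ∀ x, V (-x) = - V x := by
    intro x
    have : ∫ φ in (0:ℝ)..x, q φ = ∫ φ in (0:ℝ)..x, q (-φ) := by
      congr 1; ext φ; exact (hev s φ).symm
    simp only [V]
    rw [this, intervalIntegral.integral_comp_neg, intervalIntegral.integral_symm, neg_zero]
  have hsub : ∀ a b, ∫ φ in a..b, q φ = V b - V a := fun a b =>
    (intervalIntegral.integral_interval_sub_left (hqc.intervalIntegrable _ _) (hqc.intervalIntegrable _ _)).symm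
  have e1 : ∀ α, vst v s (θ + α) = V (θ + α) + V (θ + α) := by
    intro α
    show ∫ φ in (-(θ + α))..(θ + α), q φ = _
    rw [hsub, hVo]; ring
  have e2 : ∀ α : ℝ, ∫ φ in (-θ)..θ, v (s + (φ + α : ℝ) * Complex.I) = V (θ + α) + V (θ - α) := by
    intro α
    rw [show (fun φ : ℝ => v (s + (φ + α : ℝ) * Complex.I)) = fun φ => q (φ + α) from rfl, intervalIntegral.integral_comp_add_right, hsub,
      show -θ + α = -(θ - α) by ring, hVo]; ring
  simp only [e1, e2]
  rw [intervalIntegral.integral_add, intervalIntegral.integral_add]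
  · congr 1
    have := intervalIntegral.integral_comp_neg (fun α => V (θ + α)) (a := -A) (b := A)
    rw [neg_neg] at this
    rw [← this]; simp only [sub_eq_add_neg]
  all_goals exact Continuous.intervalIntegrable (by fun_prop) _ _

lemma vst_mean (v : ℂ → ℝ) (hv : Continuous v) (hev : ∀ s φ : ℝ, v (s + (-φ : ℝ) * Complex.I) = v (s + φ * Complex.I))
    (hh : ∀ ζ : ℂ, ∀ t, 0 < t → |ζ.im| + t < Real.pi → Real.circleAverage v ζ t = v ζ)
    (s0 θ ρ : ℝ) (hρ : 0 < ρ) (hθ : 0 ≤ θ) (hθρ : θ + ρ < Real.pi) :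
    ∫ s in (-ρ)..ρ, ∫ α in (-√(ρ^2 - s^2))..√(ρ^2 - s^2), vst v (s0 + s) (θ + α) = Real.pi * ρ^2 * vst v s0 θ := by
  have : ∀ s : ℝ, ∫ α in (-√(ρ^2 - s^2))..√(ρ^2 - s^2), vst v (s0 + s) (θ + α) = ∫ α in (-√(ρ^2 - s^2))..√(ρ^2 - s^2), ∫ φ in (-θ)..θ, v ((s0 + φ * Complex.I) + s + α * Complex.I) := by
    intro s
    rw [vst_shift v hv hev]
    congr 1; ext α; congr 1; ext φ; congr 1; push_cast; ring
  simp only [this]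
  rw [← swap_disc (fun φ s α => v ((s0 + φ * Complex.I) + s + α * Complex.I)) (by fun_prop), vst, ← intervalIntegral.integral_const_mul]
  refine intervalIntegral.integral_congr fun φ hφ => ?_
  rw [uIcc_of_le (by linarith)] at hφ
  apply disc_mean v hv _ _ hρ
  intro t ht
  apply hh _ _ ht.1
  have : |((s0:ℂ) + φ * Complex.I).im| ≤ θ := by simp; exact abs_le.2 hφ
  linarith [ht.2]

lemma u_side (u : ℂ → ℝ) (hu : Continuous u) (hp : ∀ z, u (z + 2 * Real.pi * Complex.I) = u z)
    (s0 ρ : ℝ) (hρ : 0 < ρ)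
    (hsub : ∀ φ : ℝ, ∀ t ∈ Ioc 0 ρ, u (s0 + φ * Complex.I) ≤ Real.circleAverage u (s0 + φ * Complex.I) t)
    (e : ℝ → ℝ) (hec : Continuous e) (h0 : ∀ x, 0 ≤ e x) (hep : Function.Periodic e (2 * Real.pi)) :
    Real.pi * ρ^2 * ∫ φ in (-Real.pi)..Real.pi, e φ * u (s0 + φ * Complex.I) ≤
     ∫ s in (-ρ)..ρ, ∫ x in (-Real.pi)..Real.pi, u ((s0 + s : ℝ) + x * Complex.I) * ∫ y in (x - √(ρ^2 - s^2))..(x + √(ρ^2 - s^2)), e y := by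
  have hpi := Real.pi_pos
  have h1 : Real.pi * ρ^2 * ∫ φ in (-Real.pi)..Real.pi, e φ * u (s0 + φ * Complex.I) ≤
     ∫ φ in (-Real.pi)..Real.pi, ∫ s in (-ρ)..ρ, ∫ α in (-√(ρ^2 - s^2))..√(ρ^2 - s^2), e φ * u ((s0 + φ * Complex.I) + s + α * Complex.I) := by
    rw [← intervalIntegral.integral_const_mul]
    refine intervalIntegral.integral_mono_on (by linarith) (Continuous.intervalIntegrable (by fun_prop) _ _) (Continuous.intervalIntegrable ?_ _ _) fun φ _ => ?_
    · apply pint_cont (fun (φ s : ℝ) => ∫ α in (-√(ρ^2 - s^2))..√(ρ^2 - s^2), e φ * u ((s0 + φ * Complex.I) + s + α * Complex.I)) _ _ _ continuous_const continuous_const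
      apply pint_cont (fun (x : ℝ × ℝ) (α : ℝ) => e x.1 * u ((s0 + x.1 * Complex.I) + x.2 + α * Complex.I))
      · simp only [Function.uncurry_def]; fun_prop
      · fun_prop
      · fun_prop
    · simp only [intervalIntegral.integral_const_mul]
      have := disc_submean u hu (s0 + φ * Complex.I) ρ hρ (hsub φ)
      have := mul_le_mul_of_nonneg_left this (h0 φ)
      linarith
  refine h1.trans (le_of_eq ?_)
  rw [swap_disc (fun φ s α => e φ * u ((s0 + φ * Complex.I) + s + α * Complex.I)) (by fun_prop)]
  congr 1; ext s
  set A := √(ρ^2 - s^2)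
  set q : ℝ → ℝ := fun x => u ((s0 + s : ℝ) + x * Complex.I) with hq
  have hqc : Continuous q := by fun_prop
  have hqp : Function.Periodic q (2 * Real.pi) := by
    intro x; simp only [hq]
    rw [← hp ((s0 + s : ℝ) + x * Complex.I)]; congr 1; push_cast; ring
  have e1 : ∀ α : ℝ, ∫ φ in (-Real.pi)..Real.pi, e φ * u ((s0 + φ * Complex.I) + s + α * Complex.I) = ∫ x in (-Real.pi)..Real.pi, e (x - α) * q x := by
    intro α
    have hper : Function.Periodic (fun x => e (x - α) * q x) (2 * Real.pi) := by
      intro x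
      simp only
      rw [hqp, show x + 2 * Real.pi - α = (x - α) + 2 * Real.pi by ring, hep]
    have h3 := hper.intervalIntegral_add_eq (-Real.pi) (-Real.pi + α)
    rw [show -Real.pi + 2 * Real.pi = Real.pi by ring, show -Real.pi + α + 2 * Real.pi = Real.pi + α by ring] at h3
    rw [h3, ← intervalIntegral.integral_comp_add_right (fun x => e (x - α) * q x)]
    congr 1; ext φ
    simp only [hq, add_sub_cancel_right]
    congr 2; push_cast; ring
  simp only [e1]
  rw [swap_int (fun α x => e (x - α) * q x) (by simp only [Function.uncurry_def]; fun_prop)]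
  congr 1; ext x
  rw [intervalIntegral.integral_mul_const, mul_comm, intervalIntegral.integral_comp_sub_left (fun y => e y), sub_neg_eq_add]

end

section
open MeasureTheory Set

lemma vst_ge (v : ℂ → ℝ) (hv : Continuous v) (s θ : ℝ) (hθ : 0 ≤ θ) (c : ℝ) (h : ∀ φ : ℝ, c ≤ v (s + φ * Complex.I)) :
    2 * θ * c ≤ vst v s θ := by
  have : 2 * θ * c = ∫ φ in (-θ)..θ, c := by rw [intervalIntegral.integral_const, smul_eq_mul]; ring
  rw [this, vst]
  exact intervalIntegral.integral_mono_on (by linarith) (by simp) (Continuous.intervalIntegrable (by fun_prop) _ _) fun x _ => h x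

lemma vst_add (v : ℂ → ℝ) (hv : Continuous v) (hev : ∀ s φ : ℝ, v (s + (-φ : ℝ) * Complex.I) = v (s + φ * Complex.I)) (s a b : ℝ) :
    vst v s b - vst v s a = 2 * ∫ φ in a..b, v (s + φ * Complex.I) := by
  set q : ℝ → ℝ := fun φ => v (s + φ * Complex.I) with hq
  have hqc : Continuous q := by fun_prop
  have hi : ∀ a b, IntervalIntegrable q volume a b := fun a b => hqc.intervalIntegrable _ _
  have hs : ∫ φ in (-b)..(-a), q φ = ∫ φ in a..b, q φ := by
    rw [← intervalIntegral.integral_comp_neg]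
    congr 1; ext φ; exact hev s φ
  show (∫ φ in (-b)..b, q φ) - ∫ φ in (-a)..a, q φ = _
  rw [← intervalIntegral.integral_add_adjacent_intervals (hi (-b) (-a)) (hi (-a) b), ← intervalIntegral.integral_add_adjacent_intervals (hi (-a) a) (hi a b), hs]
  ring

lemma interior_no_max (u v : ℂ → ℝ) (hu : Continuous u) (hu0 : ∀ z, 0 ≤ u z)
    (hup : ∀ z, u (z + 2 * Real.pi * Complex.I) = u z)
    (hsub : ∀ s0 : ℝ, ∃ ρ0 > 0, ∀ φ : ℝ, ∀ t ∈ Ioc 0 ρ0, u (s0 + φ * Complex.I) ≤ Real.circleAverage u (s0 + φ * Complex.I) t)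
    (hv : Continuous v)
    (hev : ∀ s φ : ℝ, v (s + (-φ : ℝ) * Complex.I) = v (s + φ * Complex.I))
    (hmono : ∀ s a b : ℝ, 0 ≤ a → a ≤ b → b ≤ Real.pi → v (s + b * Complex.I) ≤ v (s + a * Complex.I))
    (hh : ∀ ζ : ℂ, ∀ t, 0 < t → |ζ.im| + t < Real.pi → Real.circleAverage v ζ t = v ζ)
    (ε : ℝ) (hε : 0 < ε) (s0 θ0 : ℝ) (hθ0 : 0 < θ0) (hθπ : θ0 < Real.pi) (m : ℝ)
    (hm : m = SS u (s0, θ0) - vst v s0 θ0 - (4 * ε * θ0 - ε / Real.pi * θ0^2))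
    (hmax : ∀ s θ, 0 ≤ θ → θ ≤ Real.pi → SS u (s, θ) - vst v s θ - (4 * ε * θ - ε / Real.pi * θ^2) ≤ m) : False := by
  have hpi := Real.pi_pos
  obtain ⟨ρ0, hρ0, hsub⟩ := hsub s0
  obtain ⟨ρ, hρ, hρ1⟩ : ∃ ρ, 0 < ρ ∧ ρ < min ρ0 (min θ0 (Real.pi - θ0)) := exists_between (by
    apply lt_min hρ0; exact lt_min hθ0 (by linarith))
  rw [lt_min_iff, lt_min_iff] at hρ1
  obtain ⟨hρa, hρb, hρc⟩ := hρ1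
  set κ := ∫ s in (-ρ)..ρ, (2/3) * √(ρ^2 - s^2)^3 with hκ
  have hκ0 : 0 < κ := by
    apply intervalIntegral.intervalIntegral_pos_of_pos_on (Continuous.intervalIntegrable (by fun_prop) _ _) _ (by linarith)
    intro x hx
    have : 0 < ρ^2 - x^2 := by nlinarith [hx.1, hx.2]
    positivity
  set p : ℝ → ℝ := fun θ => 4 * ε * θ - ε / Real.pi * θ^2 with hp
  have hpc : Continuous p := by fun_prop
  obtain ⟨δ, hδ, hδκ⟩ : ∃ δ, 0 < δ ∧ Real.pi * ρ^2 * (2 * Real.pi * δ) < ε / Real.pi * κ := by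
    refine ⟨ε / Real.pi * κ / (Real.pi * ρ^2 * (2 * Real.pi) * 2), by positivity, ?_⟩
    have : 0 < ε / Real.pi * κ := by positivity
    have h2 : Real.pi * ρ^2 * (2 * Real.pi * (ε / Real.pi * κ / (Real.pi * ρ^2 * (2 * Real.pi) * 2))) = (ε / Real.pi * κ) / 2 := by
      field_simp
    rw [h2]; linarith
  obtain ⟨e, hec, he0, he1, hep, heI, heS⟩ := SS_attain u hu hu0 hup s0 θ0 hθ0.le hθπ.le δ hδ
  have hU := u_side u hu hup s0 ρ hρ (fun φ t ht => hsub φ t ⟨ht.1, ht.2.trans hρa.le⟩) e hec he0 hep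
  have hvc := vst_cont v hv
  have hR : ∫ s in (-ρ)..ρ, ∫ x in (-Real.pi)..Real.pi, u ((s0 + s : ℝ) + x * Complex.I) * ∫ y in (x - √(ρ^2 - s^2))..(x + √(ρ^2 - s^2)), e y
      ≤ ∫ s in (-ρ)..ρ, ∫ α in (-√(ρ^2 - s^2))..√(ρ^2 - s^2), (vst v (s0 + s) (θ0 + α) + p (θ0 + α) + m) := by
    refine intervalIntegral.integral_mono_on_of_le_Ioo (by linarith) (Continuous.intervalIntegrable ?_ _ _) (Continuous.intervalIntegrable ?_ _ _) fun s hs => ?_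
    · apply pint_cont _ _ _ _ continuous_const continuous_const
      simp only [Function.uncurry_def]
      refine Continuous.mul (by fun_prop) ?_
      apply pint_cont (fun (x : ℝ × ℝ) (y : ℝ) => e y) (by simp only [Function.uncurry_def]; fun_prop) <;> fun_prop
    · apply pint_cont _ _ _ _ (by fun_prop) (by fun_prop)
      simp only [Function.uncurry_def]
      have := hvc.comp (by fun_prop : Continuous fun x : ℝ × ℝ => (s0 + x.1, θ0 + x.2))
      refine Continuous.add (Continuous.add this (by fun_prop)) (by fun_prop)
    · have hs2 : 0 < ρ^2 - s^2 := by nlinarith [hs.1, hs.2]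
      have hA : √(ρ^2 - s^2) ≤ ρ := by
        rw [Real.sqrt_le_left hρ.le]; nlinarith [sq_nonneg s]
      have hws : Continuous (fun θ => vst v (s0 + s) θ + p θ + m) := by
        have := hvc.comp (by fun_prop : Continuous fun x : ℝ => (s0 + s, x))
        exact Continuous.add (Continuous.add this (by fun_prop)) (by fun_prop)
      refine rearr e hec.measurable he0 he1 hep θ0 _ (Real.sqrt_pos.2 hs2) (by linarith) (by linarith) heI (fun x : ℝ => u ((s0 + s : ℝ) + x * Complex.I)) (by fun_prop) (fun θ => vst v (s0 + s) θ + p θ + m) hws ?_ ?_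
      · intro G hG
        have hle := le_SS u hu (s0 + s) (G.indicator 1) (measurable_one.indicator hG) (fun x => indicator_nonneg (by simp) x) (fun x => indicator_le_self' (by simp) x)
        have i1 : ∫ φ in (-Real.pi)..Real.pi, G.indicator (1 : ℝ → ℝ) φ = volume.real (Ioc (-Real.pi) Real.pi ∩ G) := by
          rw [intervalIntegral.integral_of_le (by linarith), setIntegral_indicator hG]; simp
        have i2 : ∫ φ in (-Real.pi)..Real.pi, G.indicator (1 : ℝ → ℝ) φ * u ((s0 + s : ℝ) + φ * Complex.I) = ∫ x in Ioc (-Real.pi) Real.pi ∩ G, u ((s0 + s : ℝ) + x * Complex.I) := by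
          rw [intervalIntegral.integral_of_le (by linarith), ← setIntegral_indicator hG]
          congr 1; ext x
          by_cases hx : x ∈ G <;> simp [hx]
        rw [i1, i2] at hle
        have hb : volume.real (Ioc (-Real.pi) Real.pi ∩ G) ≤ 2 * Real.pi := by
          have := measureReal_mono (μ := volume) (inter_subset_left : Ioc (-Real.pi) Real.pi ∩ G ⊆ _) (by simp)
          rw [Real.volume_real_Ioc_of_le (by linarith)] at this
          linarith
        have := hmax (s0 + s) (volume.real (Ioc (-Real.pi) Real.pi ∩ G) / 2) (by positivity) (by linarith)
        simp only [hp] 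
        linarith
      · intro y hy
        refine ⟨2 * v ((s0 + s : ℝ) + y * Complex.I) + (4 * ε - ε / Real.pi * (2 * y)), ?_, ?_⟩
        · intro a b hya hab hb
          have h1 := vst_add v hv hev (s0 + s) a b
          have h2 : ∫ φ in a..b, v ((s0 + s : ℝ) + φ * Complex.I) ≤ ∫ φ in a..b, v ((s0 + s : ℝ) + y * Complex.I) :=
            intervalIntegral.integral_mono_on hab (Continuous.intervalIntegrable (by fun_prop) _ _) (by simp) fun x hx => hmono _ _ _ hy.1 (hya.trans hx.1) (hx.2.trans hb)
          simp only [intervalIntegral.integral_const, smul_eq_mul] at h2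
          have h3 : p b - p a ≤ (4 * ε - ε / Real.pi * (2 * y)) * (b - a) := by
            have : (4 * ε - ε / Real.pi * (2 * y)) * (b - a) - (p b - p a) = ε / Real.pi * (b - a) * (a + b - 2 * y) := by simp only [hp]; ring
            have : 0 ≤ ε / Real.pi * (b - a) * (a + b - 2 * y) := mul_nonneg (mul_nonneg (by positivity) (by linarith)) (by linarith)
            linarith
          linarith
        · intro a b ha hab hb
          have h1 := vst_add v hv hev (s0 + s) a b
          have h2 : ∫ φ in a..b, v ((s0 + s : ℝ) + y * Complex.I) ≤ ∫ φ in a..b, v ((s0 + s : ℝ) + φ * Complex.I) :=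
            intervalIntegral.integral_mono_on hab (by simp) (Continuous.intervalIntegrable (by fun_prop) _ _) fun x hx => hmono _ _ _ (ha.trans hx.1) (hx.2.trans hb) hy.2
          simp only [intervalIntegral.integral_const, smul_eq_mul] at h2
          have h3 : (4 * ε - ε / Real.pi * (2 * y)) * (b - a) ≤ p b - p a := by
            have : (p b - p a) - (4 * ε - ε / Real.pi * (2 * y)) * (b - a) = ε / Real.pi * (b - a) * (2 * y - a - b) := by simp only [hp]; ring
            have : 0 ≤ ε / Real.pi * (b - a) * (2 * y - a - b) := mul_nonneg (mul_nonneg (by positivity) (by linarith)) (by linarith)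
            linarith
          linarith
  have hV := vst_mean v hv hev hh s0 θ0 ρ hρ hθ0.le (by linarith)
  have hcirc : ∫ s in (-ρ)..ρ, 2 * √(ρ^2 - s^2) = Real.pi * ρ^2 := by
    have := disc_mean (fun _ => 1) continuous_const 0 ρ hρ (fun t _ => by simp [Real.circleAverage_const])
    simp only [intervalIntegral.integral_const, smul_eq_mul, mul_one] at this
    rw [← this]; congr 1; ext s; ring
  have hsplit : ∫ s in (-ρ)..ρ, ∫ α in (-√(ρ^2 - s^2))..√(ρ^2 - s^2), (vst v (s0 + s) (θ0 + α) + p (θ0 + α) + m)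
      = Real.pi * ρ^2 * (vst v s0 θ0 + p θ0 + m) - ε / Real.pi * κ := by
    have : ∀ s, ∫ α in (-√(ρ^2 - s^2))..√(ρ^2 - s^2), (vst v (s0 + s) (θ0 + α) + p (θ0 + α) + m) = (∫ α in (-√(ρ^2 - s^2))..√(ρ^2 - s^2), vst v (s0 + s) (θ0 + α)) + (2 * √(ρ^2 - s^2) * (p θ0 + m) - ε / Real.pi * ((2/3) * √(ρ^2 - s^2)^3)) := by
      intro s
      simp only [add_assoc]
      rw [intervalIntegral.integral_add]
      · congr 1
        have : ∀ α, p (θ0 + α) + m = (p θ0 + m) + ((4 * ε - 2 * (ε / Real.pi) * θ0) * α - ε / Real.pi * α^2) := by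
          intro α; simp only [hp]; ring
        simp only [this]
        rw [intervalIntegral.integral_add (by simp) (Continuous.intervalIntegrable (by fun_prop) _ _), intervalIntegral.integral_sub (Continuous.intervalIntegrable (by fun_prop) _ _) (Continuous.intervalIntegrable (by fun_prop) _ _), intervalIntegral.integral_const_mul, intervalIntegral.integral_const_mul, integral_id, integral_pow]
        simp; ring
      · have := hvc.comp (by fun_prop : Continuous fun x : ℝ => (s0 + s, θ0 + x))
        exact this.intervalIntegrable _ _
      · exact Continuous.intervalIntegrable (by fun_prop) _ _
    simp only [this]
    rw [intervalIntegral.integral_add, hV, intervalIntegral.integral_sub, intervalIntegral.integral_mul_const, hcirc, intervalIntegral.integral_const_mul, ← hκ]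
    · ring
    · exact Continuous.intervalIntegrable (by fun_prop) _ _
    · exact Continuous.intervalIntegrable (by fun_prop) _ _
    · apply Continuous.intervalIntegrable
      apply pint_cont _ _ _ _ (by fun_prop) (by fun_prop)
      simp only [Function.uncurry_def]
      exact hvc.comp (by fun_prop : Continuous fun x : ℝ × ℝ => (s0 + x.1, θ0 + x.2))
    · exact Continuous.intervalIntegrable (by fun_prop) _ _
  have hfin : Real.pi * ρ^2 * (SS u (s0, θ0) - 2 * Real.pi * δ) ≤ Real.pi * ρ^2 * (vst v s0 θ0 + p θ0 + m) - ε / Real.pi * κ := by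
    rw [← hsplit]
    exact (mul_le_mul_of_nonneg_left heS (by positivity)).trans (hU.trans hR)
  have : vst v s0 θ0 + p θ0 + m = SS u (s0, θ0) := by simp only [hm, hp]; ring
  rw [this] at hfin
  linarith

end

section
open MeasureTheory Set

/-- hypotheses bundle -/
structure CompHyp (u v : ℂ → ℝ) : Prop where
  hu : Continuous u
  hu0 : ∀ z, 0 ≤ u z
  hup : ∀ z, u (z + 2 * Real.pi * Complex.I) = u z
  hsub : ∀ s0 : ℝ, ∃ ρ0 > 0, ∀ φ : ℝ, ∀ t ∈ Ioc 0 ρ0, u (s0 + φ * Complex.I) ≤ Real.circleAverage u (s0 + φ * Complex.I) t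
  huz : ∃ smax : ℝ, ∀ s φ : ℝ, smax ≤ s → u (s + φ * Complex.I) = 0
  hul : ∀ η > 0, ∃ s1 : ℝ, ∀ s φ : ℝ, s ≤ s1 → u (s + φ * Complex.I) ≤ - s / 2 + η
  hualt : ∀ s : ℝ, (∃ φ : ℝ, u (s + φ * Complex.I) = 0) ∨ ∫ φ in (-Real.pi)..Real.pi, u (s + φ * Complex.I) ≤ - Real.pi * s
  hv : Continuous v
  hv0 : ∀ z, 0 ≤ v z
  hev : ∀ s φ : ℝ, v (s + (-φ : ℝ) * Complex.I) = v (s + φ * Complex.I)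
  hmono : ∀ s a b : ℝ, 0 ≤ a → a ≤ b → b ≤ Real.pi → v (s + b * Complex.I) ≤ v (s + a * Complex.I)
  hh : ∀ ζ : ℂ, ∀ t, 0 < t → |ζ.im| + t < Real.pi → Real.circleAverage v ζ t = v ζ
  hvl : ∀ η > 0, ∃ s1 : ℝ, ∀ s φ : ℝ, s ≤ s1 → - s / 2 - η ≤ v (s + φ * Complex.I)
  hvint : ∀ s : ℝ, - Real.pi * s ≤ ∫ φ in (-Real.pi)..Real.pi, v (s + φ * Complex.I)

lemma boundary_pi {u v : ℂ → ℝ} (H : CompHyp u v) (ε : ℝ) (hε : 0 < ε) (s0 : ℝ) (hz : ∃ φ : ℝ, u (s0 + φ * Complex.I) = 0) :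
    ∃ θ, 0 ≤ θ ∧ θ ≤ Real.pi ∧ SS u (s0, Real.pi) - vst v s0 Real.pi - (4 * ε * Real.pi - ε / Real.pi * Real.pi^2) < SS u (s0, θ) - vst v s0 θ - (4 * ε * θ - ε / Real.pi * θ^2) := by
  have hpi := Real.pi_pos
  obtain ⟨hu, hu0, hup, -, -, -, -, hv, hv0, hev, -⟩ := H
  set q : ℝ → ℝ := fun φ => u (s0 + φ * Complex.I) with hq
  have hqc : Continuous q := by fun_prop
  have hqp : Function.Periodic q (2 * Real.pi) := by
    intro x; simp only [hq]
    rw [← hup (s0 + x * Complex.I)]; congr 1; push_cast; ring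
  obtain ⟨φ0, hφ0⟩ := hz
  obtain ⟨φ1, hφ1, hq1⟩ := hqp.exists_mem_Ioc (by positivity) φ0 (-Real.pi)
  have hq1 : q φ1 = 0 := by rw [← hq1]; exact hφ0
  rw [show -Real.pi + 2 * Real.pi = Real.pi by ring] at hφ1
  have hO : IsOpen {φ | q φ < ε / 2} := isOpen_lt hqc continuous_const
  set E := {φ | q φ < ε / 2} with hE
  have hne : (E ∩ Ioo (-Real.pi) Real.pi).Nonempty := by
    have : φ1 ∈ closure (Ioo (-Real.pi) Real.pi) := by
      rw [closure_Ioo (by linarith)]; exact Ioc_subset_Icc_self hφ1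
    exact mem_closure_iff.1 this E hO (by simp [hE, hq1]; exact hε)
  have hpos : 0 < volume.real (Ioc (-Real.pi) Real.pi ∩ E) := by
    have h1 := (hO.inter isOpen_Ioo).measure_pos volume hne
    refine ENNReal.toReal_pos (ne_of_gt (h1.trans_le (measure_mono ?_))) ?_
    · rintro x ⟨a, b⟩; exact ⟨Ioo_subset_Ioc_self b, a⟩
    · exact ne_top_of_le_ne_top (by simp) (measure_mono inter_subset_left)
  set β := volume.real (Ioc (-Real.pi) Real.pi ∩ E) / 2 with hβ
  have hβ0 : 0 < β := by positivity
  have i1 : ∫ φ in (-Real.pi)..Real.pi, E.indicator (1 : ℝ → ℝ) φ = 2 * β := by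
    rw [intervalIntegral.integral_of_le (by linarith), setIntegral_indicator hO.measurableSet]; simp [hβ]; ring
  have hie : IntervalIntegrable (E.indicator (1 : ℝ → ℝ)) volume (-Real.pi) Real.pi := by
    refine IntervalIntegrable.mono_fun' (g := fun _ => 1) (by simp) (measurable_one.indicator hO.measurableSet).aestronglyMeasurable ?_
    exact Filter.Eventually.of_forall fun x => by
      show ‖E.indicator (1 : ℝ → ℝ) x‖ ≤ 1
      by_cases hx : x ∈ E <;> simp [hx]
  have hbd : ∀ x, 0 ≤ E.indicator (1 : ℝ → ℝ) x ∧ E.indicator (1 : ℝ → ℝ) x ≤ 1 := by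
    intro x; by_cases hx : x ∈ E <;> simp [hx]
  have hβπ : β ≤ Real.pi := by
    have : ∫ φ in (-Real.pi)..Real.pi, E.indicator (1 : ℝ → ℝ) φ ≤ ∫ φ in (-Real.pi)..Real.pi, 1 :=
      intervalIntegral.integral_mono_on (by linarith) hie (by simp) fun x _ => (hbd x).2
    rw [i1] at this; simp at this; linarith
  have hle := le_SS u hu s0 (fun x => 1 - E.indicator 1 x) (measurable_const.sub (measurable_one.indicator hO.measurableSet)) (fun x => by have := (hbd x).2; linarith) (fun x => by have := (hbd x).1; linarith)
  rw [intervalIntegral.integral_sub (by simp) hie, i1] at hle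
  have e1 : ((∫ φ in (-Real.pi)..Real.pi, (1:ℝ)) - 2 * β) / 2 = Real.pi - β := by simp; ring
  rw [e1] at hle
  have e2 : (∫ φ in (-Real.pi)..Real.pi, q φ) - ε / 2 * (2 * β) ≤ ∫ φ in (-Real.pi)..Real.pi, (1 - E.indicator 1 φ) * u (s0 + φ * Complex.I) := by
    rw [← i1, ← intervalIntegral.integral_const_mul, ← intervalIntegral.integral_sub (hqc.intervalIntegrable _ _) (hie.const_mul _)]
    refine intervalIntegral.integral_mono_on (by linarith) ((hqc.intervalIntegrable _ _).sub (hie.const_mul _)) (IntervalIntegrable.mul_continuousOn ((by simp : IntervalIntegrable (fun _ => (1:ℝ)) volume _ _).sub hie) hqc.continuousOn) fun x _ => ?_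
    by_cases hx : x ∈ E
    · have : q x < ε / 2 := hx
      simp [hx]; linarith
    · simp [hx, hq]
  have e3 := SS_le u s0 Real.pi hpi.le 0 le_rfl
  have e4 : NN u 0 s0 = ∫ φ in (-Real.pi)..Real.pi, q φ := by
    rw [NN]; congr 1; ext φ; simp [hq, hu0]
  have e5 := vst_add v hv hev s0 (Real.pi - β) Real.pi
  have e6 : 0 ≤ ∫ φ in (Real.pi - β)..Real.pi, v (s0 + φ * Complex.I) := intervalIntegral.integral_nonneg (by linarith) fun x _ => hv0 _
  refine ⟨Real.pi - β, by linarith, by linarith, ?_⟩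
  have e7 : (4 * ε * Real.pi - ε / Real.pi * Real.pi^2) - (4 * ε * (Real.pi - β) - ε / Real.pi * (Real.pi - β)^2) = 2 * ε * β + ε / Real.pi * β^2 := by
    field_simp; ring
  have e8 : 0 ≤ ε / Real.pi * β^2 := by positivity
  have : 0 < ε * β := by positivity
  linarith

lemma SS_le_vst {u v : ℂ → ℝ} (H : CompHyp u v) (s θ : ℝ) (h0 : 0 ≤ θ) (h1 : θ ≤ Real.pi) : SS u (s, θ) ≤ vst v s θ := by
  have hpi := Real.pi_pos
  have main : ∀ ε > 0, SS u (s, θ) - vst v s θ - (4 * ε * θ - ε / Real.pi * θ^2) ≤ 0 := by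
    intro ε hε
    by_contra hcon
    push Not at hcon
    set D : ℝ × ℝ → ℝ := fun p => SS u p - vst v p.1 p.2 - (4 * ε * p.2 - ε / Real.pi * p.2^2) with hD
    set m1 := D (s, θ) with hm1
    have hm1p : 0 < m1 := hcon
    have hpn : ∀ t, 0 ≤ t → t ≤ Real.pi → 0 ≤ 4 * ε * t - ε / Real.pi * t^2 := by
      intro t a b
      have : ε / Real.pi * t^2 = ε * t * (t / Real.pi) := by ring
      have h2 : t / Real.pi ≤ 1 := (div_le_one hpi).2 b
      have h3 : 0 ≤ ε * t := by positivity
      nlinarith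
    obtain ⟨smax, hsmax⟩ := H.huz
    have hη : 0 < m1 / (8 * Real.pi) := by positivity
    set η := m1 / (8 * Real.pi)
    have hηm : 4 * Real.pi * η < m1 := by
      have : 4 * Real.pi * η = m1 / 2 := by simp only [η]; field_simp; norm_num
      linarith
    obtain ⟨sa, hsa⟩ := H.hul η hη
    obtain ⟨sb, hsb⟩ := H.hvl η hη
    set smin := min (min sa sb) (-2 * η) with hsmin
    have hlow : ∀ s' t, s' ≤ smin → 0 ≤ t → t ≤ Real.pi → D (s', t) < m1 := by
      intro s' t hs' ht ht'
      have ha := hs'.trans ((min_le_left _ _).trans (min_le_left _ _))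
      have hb := hs'.trans ((min_le_left _ _).trans (min_le_right _ _))
      have hc := hs'.trans (min_le_right _ _)
      have g1 := SS_le u s' t ht (-s'/2 - η) (by linarith)
      have g2 : NN u (-s'/2 - η) s' ≤ ∫ φ in (-Real.pi)..Real.pi, 2 * η := by
        have := H.hu
        refine intervalIntegral.integral_mono_on (by linarith) (Continuous.intervalIntegrable (by fun_prop) _ _) (by simp) fun x _ => ?_
        have := hsa s' x ha
        exact max_le (by linarith) (by linarith)
      have g3 := vst_ge v H.hv s' t ht (-s'/2 - η) (fun φ => hsb s' φ hb)
      have g4 := hpn t ht ht'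
      simp only [intervalIntegral.integral_const, smul_eq_mul] at g2
      simp only [hD]
      linarith
    have hvn : ∀ s' t, 0 ≤ t → 0 ≤ vst v s' t := fun s' t ht => intervalIntegral.integral_nonneg (by linarith) fun x _ => H.hv0 _
    have hhigh : ∀ s' t, smax ≤ s' → 0 ≤ t → t ≤ Real.pi → D (s', t) < m1 := by
      intro s' t hs' ht ht'
      have g1 := SS_le u s' t ht 0 le_rfl
      have g2 : NN u 0 s' = 0 := by
        simp [NN, hsmax s' _ hs']
      have g3 := hpn t ht ht'
      have g4 := hvn s' t ht
      simp only [hD]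
      linarith
    set K : Set (ℝ × ℝ) := Icc smin smax ×ˢ Icc 0 Real.pi with hK
    have hin : (s, θ) ∈ K := by
      refine ⟨⟨?_, ?_⟩, h0, h1⟩
      · by_contra h; exact lt_irrefl _ (hlow s θ (by simp only at h; linarith) h0 h1)
      · by_contra h; exact lt_irrefl _ (hhigh s θ (by simp only at h; linarith) h0 h1)
    have husc : UpperSemicontinuousOn D K := by
      have c1 : Continuous fun p : ℝ × ℝ => - vst v p.1 p.2 - (4 * ε * p.2 - ε / Real.pi * p.2^2) := by
        have := vst_cont v H.hv
        fun_prop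
      have := (SS_usc u H.hu K (fun p hp => hp.2.1)).add c1.continuousOn.upperSemicontinuousOn
      have e : D = fun p => SS u p + (- vst v p.1 p.2 - (4 * ε * p.2 - ε / Real.pi * p.2^2)) := by
        ext p; simp only [hD]; ring
      rw [e]; exact this
    obtain ⟨⟨s0, θ0⟩, hmem, hmax⟩ := UpperSemicontinuousOn.exists_isMaxOn ⟨_, hin⟩ (isCompact_Icc.prod isCompact_Icc) husc
    have hm0 : m1 ≤ D (s0, θ0) := hmax hin
    have hglob : ∀ s' t, 0 ≤ t → t ≤ Real.pi → D (s', t) ≤ D (s0, θ0) := by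
      intro s' t ht ht'
      by_cases h : (s', t) ∈ K
      · exact hmax h
      · have : s' ≤ smin ∨ smax ≤ s' := by
          by_contra hc; push Not at hc
          exact h ⟨⟨hc.1.le, hc.2.le⟩, ht, ht'⟩
        rcases this with h | h
        · exact (hlow s' t h ht ht').le.trans hm0
        · exact (hhigh s' t h ht ht').le.trans hm0
    have hθ0 : 0 < θ0 := by
      rcases hmem.2.1.lt_or_eq with h | h
      · exact h
      exfalso
      simp only at h
      have hqc : Continuous (fun φ : ℝ => u (s0 + φ * Complex.I)) := by have := H.hu; fun_prop
      obtain ⟨M, hM⟩ := isCompact_Icc.exists_bound_of_continuousOn (hqc.continuousOn (s := Icc (-Real.pi) Real.pi))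
      have hM0 : 0 ≤ M := le_trans (norm_nonneg _) (hM 0 ⟨by linarith, by linarith⟩)
      have g1 := SS_le u s0 0 le_rfl M hM0
      have g2 : NN u M s0 = 0 := by
        rw [NN, intervalIntegral.integral_congr (g := fun _ => 0)]; · simp
        intro φ hφ
        rw [uIcc_of_le (by linarith)] at hφ
        have := (le_abs_self _).trans (hM φ hφ)
        exact max_eq_right (by linarith)
      have : D (s0, θ0) ≤ 0 := by
        rw [← h]; simp only [hD, vst]; simp; linarith
      linarith
    have hθπ : θ0 < Real.pi := by
      rcases hmem.2.2.lt_or_eq with h | h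
      · exact h
      exfalso
      simp only at h
      rcases H.hualt s0 with hz | hI
      · obtain ⟨t, a, b, c⟩ := boundary_pi H ε hε s0 hz
        have := hglob s0 t a b
        rw [h] at this
        simp only [hD] at this
        linarith
      · have g1 := SS_le u s0 Real.pi hpi.le 0 le_rfl
        have e4 : NN u 0 s0 = ∫ φ in (-Real.pi)..Real.pi, u (s0 + φ * Complex.I) := by
          rw [NN]; congr 1; ext φ; simp [H.hu0]
        have g2 := H.hvint s0
        have g3 := hpn Real.pi hpi.le le_rfl
        rw [h] at hm0
        simp only [hD, vst] at hm0
        linarith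
    exact interior_no_max u v H.hu H.hu0 H.hup H.hsub H.hv H.hev H.hmono H.hh ε hε s0 θ0 hθ0 hθπ _ rfl hglob
  by_contra hcon
  push Not at hcon
  have h4 : 0 < SS u (s, θ) - vst v s θ := by linarith
  set d := SS u (s, θ) - vst v s θ
  have := main (d / (8 * Real.pi)) (by positivity)
  have h5 : 4 * (d / (8 * Real.pi)) * θ ≤ d / 2 := by
    rw [show 4 * (d / (8 * Real.pi)) * θ = d / 2 * (θ / Real.pi) by field_simp; ring]
    have : θ / Real.pi ≤ 1 := (div_le_one hpi).2 h1
    nlinarith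
  have h6 : 0 ≤ (d / (8 * Real.pi)) / Real.pi * θ^2 := by positivity
  linarith

theorem comparison {u v : ℂ → ℝ} (H : CompHyp u v) (s c : ℝ) (hc : 0 ≤ c) :
    ∫ φ in (-Real.pi)..Real.pi, max (u (s + φ * Complex.I) - c) 0 ≤ ∫ φ in (-Real.pi)..Real.pi, max (v (s + φ * Complex.I) - c) 0 := by
  have hpi := Real.pi_pos
  set q : ℝ → ℝ := fun φ => u (s + φ * Complex.I) with hq
  have hqc : Continuous q := by have := H.hu; fun_prop
  have hO : IsOpen {φ | c < q φ} := isOpen_lt continuous_const hqc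
  set E := {φ | c < q φ} with hE
  have hie : IntervalIntegrable (E.indicator (1 : ℝ → ℝ)) volume (-Real.pi) Real.pi := by
    refine IntervalIntegrable.mono_fun' (g := fun _ => 1) (by simp) (measurable_one.indicator hO.measurableSet).aestronglyMeasurable ?_
    exact Filter.Eventually.of_forall fun x => by
      show ‖E.indicator (1 : ℝ → ℝ) x‖ ≤ 1
      by_cases hx : x ∈ E <;> simp [hx]
  have hbd : ∀ x, 0 ≤ E.indicator (1 : ℝ → ℝ) x ∧ E.indicator (1 : ℝ → ℝ) x ≤ 1 := by
    intro x; by_cases hx : x ∈ E <;> simp [hx]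
  have hle := le_SS u H.hu s (E.indicator 1) (measurable_one.indicator hO.measurableSet) (fun x => (hbd x).1) (fun x => (hbd x).2)
  set θ := (∫ φ in (-Real.pi)..Real.pi, E.indicator (1 : ℝ → ℝ) φ) / 2 with hθ
  have hθ0 : 0 ≤ θ := by
    have : 0 ≤ ∫ φ in (-Real.pi)..Real.pi, E.indicator (1 : ℝ → ℝ) φ := intervalIntegral.integral_nonneg (by linarith) fun x _ => (hbd x).1
    positivity
  have hθ1 : θ ≤ Real.pi := by
    have : ∫ φ in (-Real.pi)..Real.pi, E.indicator (1 : ℝ → ℝ) φ ≤ ∫ φ in (-Real.pi)..Real.pi, 1 :=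
      intervalIntegral.integral_mono_on (by linarith) hie (by simp) fun x _ => (hbd x).2
    simp at this; simp [hθ]; linarith
  have h2 := hle.trans (SS_le_vst H s θ hθ0 hθ1)
  have h3 : ∫ φ in (-Real.pi)..Real.pi, max (q φ - c) 0 = (∫ φ in (-Real.pi)..Real.pi, E.indicator 1 φ * q φ) - 2 * θ * c := by
    rw [show 2 * θ * c = ∫ φ in (-Real.pi)..Real.pi, E.indicator (1 : ℝ → ℝ) φ * c by rw [intervalIntegral.integral_mul_const, hθ]; ring,
      ← intervalIntegral.integral_sub (hie.mul_continuousOn hqc.continuousOn) (hie.mul_const _)]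
    congr 1; ext φ
    by_cases hx : φ ∈ E
    · have : c < q φ := hx
      simp [hx]; linarith
    · have : ¬ c < q φ := hx
      simp [hx]; linarith
  have hvc : Continuous (fun φ : ℝ => v (s + φ * Complex.I)) := by have := H.hv; fun_prop
  have hv' := H.hv
  have h4 : vst v s θ - 2 * θ * c ≤ ∫ φ in (-Real.pi)..Real.pi, max (v (s + φ * Complex.I) - c) 0 := by
    rw [show 2 * θ * c = ∫ φ in (-θ)..θ, c by rw [intervalIntegral.integral_const, smul_eq_mul]; ring, vst,
      ← intervalIntegral.integral_sub (hvc.intervalIntegrable _ _) (by simp)]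
    refine (intervalIntegral.integral_mono_on (g := fun φ : ℝ => max (v (s + φ * Complex.I) - c) 0) (by linarith) (Continuous.intervalIntegrable (by fun_prop) _ _) (Continuous.intervalIntegrable (by fun_prop) _ _) fun x _ => le_max_left _ _).trans ?_
    refine intervalIntegral.integral_mono_interval (by linarith) (by linarith) hθ1 (Filter.Eventually.of_forall fun x => le_max_right _ _) (Continuous.intervalIntegrable (by fun_prop) _ _)
  show ∫ φ in (-Real.pi)..Real.pi, max (q φ - c) 0 ≤ _
  rw [h3]
  exact (sub_le_sub_right h2 _).trans h4

end

section
open MeasureTheory Set Filter Topology Metric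

lemma inj_nhds {F : ℂ → ℂ} {V : Set ℂ} (hV : IsOpen V) (hd : DifferentiableOn ℂ F V) (hi : InjOn F V) {z : ℂ} (hz : z ∈ V) :
    𝓝 (F z) ≤ map F (𝓝 z) := by
  have ha : AnalyticAt ℂ F z := hd.analyticAt (hV.mem_nhds hz)
  rcases ha.eventually_constant_or_nhds_le_map_nhds with h | h
  · exfalso
    have h2 : ∀ᶠ y in 𝓝 z, y = z := by
      filter_upwards [h, hV.mem_nhds hz] with y hy hyV
      exact hi hyV hz hy
    have h3 : ∀ᶠ y in 𝓝[≠] z, y = z := h2.filter_mono nhdsWithin_le_nhds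
    have h4 : ∀ᶠ y in 𝓝[≠] z, y ≠ z := self_mem_nhdsWithin
    obtain ⟨y, a, b⟩ := (h3.and h4).exists
    exact b a
  · exact h

lemma inj_image_open {F : ℂ → ℂ} {V : Set ℂ} (hV : IsOpen V) (hd : DifferentiableOn ℂ F V) (hi : InjOn F V) : IsOpen (F '' V) := by
  rw [isOpen_iff_mem_nhds]
  rintro _ ⟨z, hz, rfl⟩
  exact inj_nhds hV hd hi hz (image_mem_map (hV.mem_nhds hz))

lemma inv_diff {F : ℂ → ℂ} {V : Set ℂ} (hV : IsOpen V) (hd : DifferentiableOn ℂ F V) (hi : InjOn F V) :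
    DifferentiableOn ℂ (Function.invFunOn F V) (F '' V) := by
  have hO := inj_image_open hV hd hi
  set g := Function.invFunOn F V with hg
  have hgF : ∀ z ∈ V, g (F z) = z := fun z hz => hi.leftInvOn_invFunOn hz
  have hFg : ∀ w ∈ F '' V, F (g w) = w := by rintro _ ⟨z, hz, rfl⟩; rw [hgF z hz]
  have hgV : ∀ w ∈ F '' V, g w ∈ V := by rintro _ ⟨z, hz, rfl⟩; rw [hgF z hz]; exact hz
  have hcont : ∀ w ∈ F '' V, ContinuousAt g w := by
    rintro _ ⟨z, hz, rfl⟩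
    rw [ContinuousAt, hgF z hz]
    intro N hN
    have := inj_nhds hV hd hi hz (image_mem_map (inter_mem hN (hV.mem_nhds hz)))
    rw [mem_map]
    filter_upwards [this]
    rintro _ ⟨y, hy, rfl⟩
    show g (F y) ∈ N
    rw [hgF y hy.2]; exact hy.1
  intro w hw
  refine (Complex.analyticAt_of_differentiable_on_punctured_nhds_of_continuousAt ?_ (hcont w hw)).differentiableAt.differentiableWithinAt
  have hz := hgV w hw
  have hder : ∀ᶠ z in 𝓝[≠] (g w), deriv F z ≠ 0 := by
    have ha : AnalyticAt ℂ (deriv F) (g w) := (hd.analyticAt (hV.mem_nhds hz)).deriv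
    rcases ha.eventually_eq_zero_or_eventually_ne_zero with h | h
    · exfalso
      obtain ⟨r, hr, hball⟩ := Metric.mem_nhds_iff.1 (inter_mem h (hV.mem_nhds hz))
      have hconst : ∀ y ∈ ball (g w) r, F y = F (g w) := by
        intro y hy
        refine (convex_ball (g w) r).is_const_of_fderivWithin_eq_zero (𝕜 := ℂ) (f := F) (hd.mono fun x hx => (hball hx).2) ?_ hy (mem_ball_self hr)
        intro x hx
        rw [fderivWithin_of_isOpen isOpen_ball hx]
        ext
        have : deriv F x = 0 := (hball hx).1
        simpa using this
      have h2 : ∀ᶠ y in 𝓝[≠] (g w), y = g w := by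
        apply Filter.Eventually.filter_mono nhdsWithin_le_nhds
        filter_upwards [ball_mem_nhds (g w) hr] with y hy
        exact hi (hball hy).2 hz (hconst y hy)
      have h4 : ∀ᶠ y in 𝓝[≠] (g w), y ≠ g w := self_mem_nhdsWithin
      obtain ⟨y, a, b⟩ := (h2.and h4).exists
      exact b a
    · exact h
  have htend : Tendsto g (𝓝[≠] w) (𝓝[≠] (g w)) := by
    rw [tendsto_nhdsWithin_iff]
    refine ⟨(hcont w hw).tendsto.mono_left nhdsWithin_le_nhds, ?_⟩
    filter_upwards [self_mem_nhdsWithin, nhdsWithin_le_nhds (hO.mem_nhds hw)] with y hy hyW hyg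
    apply hy
    have := congrArg F hyg
    rw [hFg y hyW, hFg w hw] at this
    exact this
  filter_upwards [htend.eventually hder, nhdsWithin_le_nhds (hO.mem_nhds hw)] with y hy hyW
  have h1 : HasDerivAt F (deriv F (g y)) (g y) := (hd.differentiableAt (hV.mem_nhds (hgV y hyW))).hasDerivAt
  exact (HasDerivAt.of_local_left_inverse (hcont y hyW) h1 hy (by
    filter_upwards [hO.mem_nhds hyW] with x hx using hFg x hx)).differentiableAt

lemma half_angle (X : ℂ → ℝ) (hX : ∀ w, w ≠ 0 → ContinuousAt X w) (hev : ∀ w, w ≠ 0 → X (-w) = X w) (s : ℝ) :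
    ∫ φ in (-Real.pi)..Real.pi, X (Complex.exp ((s + φ * Complex.I) / 2)) = 2 * Real.pi * Real.circleAverage X 0 (Real.exp (s / 2)) := by
  have hpi := Real.pi_pos
  set k : ℝ → ℝ := fun φ => X (Complex.exp ((s + φ * Complex.I) / 2)) with hk
  have hkc : Continuous k := by
    rw [continuous_iff_continuousAt]; intro φ
    exact ContinuousAt.comp (f := fun φ : ℝ => Complex.exp ((s + φ * Complex.I) / 2)) (hX _ (Complex.exp_ne_zero _)) (by fun_prop)
  have hkp : Function.Periodic k (2 * Real.pi) := by
    intro φ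
    simp only [hk]
    rw [← hev _ (Complex.exp_ne_zero ((s + φ * Complex.I) / 2))]
    congr 1
    rw [show ((s:ℂ) + (φ + 2 * Real.pi : ℝ) * Complex.I) / 2 = (s + φ * Complex.I) / 2 + Real.pi * Complex.I by push_cast; ring, Complex.exp_add, Complex.exp_pi_mul_I]; ring
  have e1 : ∀ θ : ℝ, X (circleMap 0 (Real.exp (s / 2)) θ) = k (2 * θ) := by
    intro θ; simp only [hk, circleMap, zero_add]
    congr 1
    rw [Complex.ofReal_exp, ← Complex.exp_add]; congr 1; push_cast; ring
  rw [Real.circleAverage_def]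
  simp only [e1]
  rw [intervalIntegral.integral_comp_mul_left (fun x => k x) two_ne_zero, smul_eq_mul, smul_eq_mul]
  have h1 := hkp.intervalIntegral_add_eq (-Real.pi) 0
  have h2 := hkp.intervalIntegral_add_eq 0 (2 * Real.pi)
  rw [show -Real.pi + 2 * Real.pi = Real.pi by ring] at h1
  rw [← intervalIntegral.integral_add_adjacent_intervals (hkc.intervalIntegrable (2 * 0) (2 * Real.pi)) (hkc.intervalIntegrable (2 * Real.pi) _), show 2 * (2 * Real.pi) = 2 * Real.pi + 2 * Real.pi by ring, ← h2, h1]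
  simp; field_simp; ring

end

section
open MeasureTheory Set Filter Topology Metric

structure NiceF (F : ℂ → ℂ) (R1 : ℝ) : Prop where
  hR : 1 < R1
  hd : DifferentiableOn ℂ F (ball 0 R1)
  hi : InjOn F (ball 0 R1)
  hodd : ∀ z ∈ ball (0:ℂ) R1, F (-z) = - F z
  hder : deriv F 0 = 1

open Classical in
noncomputable def UU (F : ℂ → ℂ) (R1 : ℝ) (w : ℂ) : ℝ :=
  if w ∈ F '' ball 0 R1 then max 0 (-Real.log ‖Function.invFunOn F (ball 0 R1) w‖) else 0

namespace NiceF
variable {F : ℂ → ℂ} {R1 : ℝ} (H : NiceF F R1)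
local notation "gg" => Function.invFunOn F (ball 0 R1)
include H

lemma zero_mem : (0:ℂ) ∈ ball (0:ℂ) R1 := mem_ball_self (by linarith [H.hR])
lemma F0 : F 0 = 0 := by
  have := H.hodd 0 H.zero_mem
  rw [neg_zero] at this
  have h2 : 2 * F 0 = 0 := by linear_combination this
  simpa using h2
lemma gF {z : ℂ} (hz : z ∈ ball (0:ℂ) R1) : gg (F z) = z := H.hi.leftInvOn_invFunOn hz
lemma isOpenW : IsOpen (F '' ball 0 R1) := inj_image_open isOpen_ball H.hd H.hi
lemma gdiff : DifferentiableOn ℂ gg (F '' ball 0 R1) := inv_diff isOpen_ball H.hd H.hi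
lemma Fg {w : ℂ} (hw : w ∈ F '' ball 0 R1) : F (gg w) = w := by
  obtain ⟨z, hz, rfl⟩ := hw; rw [H.gF hz]
lemma g_mem {w : ℂ} (hw : w ∈ F '' ball 0 R1) : gg w ∈ ball (0:ℂ) R1 := by
  obtain ⟨z, hz, rfl⟩ := hw; rw [H.gF hz]; exact hz
lemma g_ne {w : ℂ} (hw : w ∈ F '' ball 0 R1) (h0 : w ≠ 0) : gg w ≠ 0 := by
  intro h; apply h0; rw [← H.Fg hw, h, H.F0]
lemma zeroW : (0:ℂ) ∈ F '' ball 0 R1 := ⟨0, H.zero_mem, H.F0⟩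
lemma g0 : gg 0 = 0 := by
  have := H.gF H.zero_mem
  rwa [H.F0] at this

lemma UF {z : ℂ} (hz : z ∈ ball (0:ℂ) R1) : UU F R1 (F z) = max 0 (-Real.log ‖z‖) := by
  rw [UU, if_pos ⟨z, hz, rfl⟩, H.gF hz]

lemma sub1 : closedBall (0:ℂ) 1 ⊆ ball 0 R1 := closedBall_subset_ball H.hR
lemma compactC : IsCompact (F '' closedBall 0 1) :=
  (isCompact_closedBall _ _).image_of_continuousOn (H.hd.continuousOn.mono H.sub1)
lemma U_zero {w : ℂ} (hw : w ∉ F '' closedBall 0 1) : UU F R1 w = 0 := by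
  rw [UU]
  split_ifs with h
  · have : gg w ∉ closedBall (0:ℂ) 1 := fun h2 => hw ⟨_, h2, H.Fg h⟩
    rw [mem_closedBall_zero_iff, not_le] at this
    exact max_eq_left (by linarith [Real.log_nonneg this.le])
  · rfl
lemma U_nonneg (w : ℂ) : 0 ≤ UU F R1 w := by
  rw [UU]; split_ifs
  · exact le_max_left _ _
  · exact le_rfl
lemma U_ge {w : ℂ} (hw : w ∈ F '' ball 0 R1) : -Real.log ‖gg w‖ ≤ UU F R1 w := by
  rw [UU, if_pos hw]; exact le_max_right _ _
lemma U_eq {w : ℂ} (hw : w ∈ F '' closedBall 0 1) : UU F R1 w = -Real.log ‖gg w‖ := by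
  obtain ⟨z, hz, rfl⟩ := hw
  rw [H.UF (H.sub1 hz), H.gF (H.sub1 hz)]
  rw [mem_closedBall_zero_iff] at hz
  exact max_eq_right (by linarith [Real.log_nonpos (norm_nonneg z) hz])

lemma U_cont {w : ℂ} (h0 : w ≠ 0) : ContinuousAt (UU F R1) w := by
  by_cases hw : w ∈ F '' ball 0 R1
  · have h1 : (UU F R1) =ᶠ[𝓝 w] fun w => max 0 (-Real.log ‖gg w‖) := by
      filter_upwards [H.isOpenW.mem_nhds hw] with y hy
      rw [UU, if_pos hy]
    refine ContinuousAt.congr ?_ h1.symm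
    have hc : ContinuousAt gg w := H.gdiff.continuousOn.continuousAt (H.isOpenW.mem_nhds hw)
    have : ContinuousAt (fun w => Real.log ‖gg w‖) w := hc.norm.log (by simpa using H.g_ne hw h0)
    exact continuousAt_const.max this.neg
  · have hn : w ∉ F '' closedBall 0 1 := fun h => hw (image_mono H.sub1 h)
    have h1 : (UU F R1) =ᶠ[𝓝 w] fun w => 0 := by
      filter_upwards [H.compactC.isClosed.isOpen_compl.mem_nhds hn] with y hy
      exact H.U_zero hy
    exact continuousAt_const.congr h1.symm

lemma U_even (w : ℂ) : UU F R1 (-w) = UU F R1 w := by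
  have key : ∀ w, w ∈ F '' ball 0 R1 → UU F R1 (-w) = UU F R1 w := by
    rintro _ ⟨z, hz, rfl⟩
    have hz' : -z ∈ ball (0:ℂ) R1 := by simpa using hz
    rw [← H.hodd z hz, H.UF hz, H.UF hz', norm_neg]
  by_cases hw : w ∈ F '' ball 0 R1
  · exact key w hw
  by_cases hw' : -w ∈ F '' ball 0 R1
  · rw [← key _ hw', neg_neg]
  · rw [UU, UU, if_neg hw, if_neg hw']

lemma u_cont : Continuous fun ζ : ℂ => UU F R1 (Complex.exp (ζ / 2)) := by
  rw [continuous_iff_continuousAt]; intro ζ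
  exact ContinuousAt.comp (f := fun ζ : ℂ => Complex.exp (ζ / 2)) (H.U_cont (Complex.exp_ne_zero _)) (by fun_prop)

lemma u_per (z : ℂ) : UU F R1 (Complex.exp ((z + 2 * Real.pi * Complex.I) / 2)) = UU F R1 (Complex.exp (z / 2)) := by
  rw [show (z + 2 * Real.pi * Complex.I) / 2 = z / 2 + Real.pi * Complex.I by ring, Complex.exp_add, Complex.exp_pi_mul_I, mul_neg_one, H.U_even]

lemma u_sub (s0 : ℝ) : ∃ ρ0 > 0, ∀ φ : ℝ, ∀ t ∈ Ioc 0 ρ0, UU F R1 (Complex.exp ((s0 + φ * Complex.I) / 2)) ≤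
    Real.circleAverage (fun ζ : ℂ => UU F R1 (Complex.exp (ζ / 2))) (s0 + φ * Complex.I) t := by
  obtain ⟨δ, hδ, hsub⟩ := H.compactC.exists_thickening_subset_open H.isOpenW (image_mono H.sub1)
  have hc : Continuous fun h : ℂ => Complex.exp (s0 / 2) * (Complex.exp (h / 2) - 1) := by fun_prop
  have h0 := hc.tendsto 0
  simp only [zero_div, Complex.exp_zero, sub_self, mul_zero] at h0
  obtain ⟨ρ0, hρ0, hball⟩ := Metric.nhds_basis_closedBall.mem_iff.1 (h0 (ball_mem_nhds 0 hδ))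
  refine ⟨ρ0, hρ0, fun φ t ht => ?_⟩
  set ζ0 : ℂ := s0 + φ * Complex.I with hζ0
  by_cases hw : Complex.exp (ζ0 / 2) ∈ F '' closedBall 0 1
  · have hmem : ∀ ζ ∈ closedBall ζ0 t, Complex.exp (ζ / 2) ∈ F '' ball 0 R1 := by
      intro ζ hζ
      apply hsub
      rw [mem_thickening_iff]
      refine ⟨_, hw, ?_⟩
      have := hball (show ζ - ζ0 ∈ closedBall 0 ρ0 by
        rw [mem_closedBall_zero_iff, ← dist_eq_norm]; exact (mem_closedBall.1 hζ).trans ht.2)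
      have h2 : ‖Complex.exp (s0 / 2) * (Complex.exp ((ζ - ζ0) / 2) - 1)‖ < δ := by simpa using this
      rw [dist_eq_norm]
      have h3 : Complex.exp (ζ / 2) - Complex.exp (ζ0 / 2) = Complex.exp (φ * Complex.I / 2) * (Complex.exp (s0 / 2) * (Complex.exp ((ζ - ζ0) / 2) - 1)) := by
        rw [mul_sub, mul_sub, mul_one, ← Complex.exp_add, ← Complex.exp_add, ← Complex.exp_add]
        congr 2
        · rw [hζ0]; ring
        · rw [hζ0]; ring
      rw [h3, norm_mul, show (φ:ℂ) * Complex.I / 2 = (φ / 2 : ℝ) * Complex.I by push_cast; ring, Complex.norm_exp_ofReal_mul_I, one_mul]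
      exact h2
    have han : AnalyticOnNhd ℂ (fun ζ => gg (Complex.exp (ζ / 2))) (closedBall ζ0 |t|) := by
      rw [abs_of_pos ht.1]
      intro ζ hζ
      have := H.gdiff.analyticAt (H.isOpenW.mem_nhds (hmem ζ hζ))
      exact AnalyticAt.comp (f := fun ζ : ℂ => Complex.exp (ζ / 2)) this (by fun_prop)
    have hnz : ∀ ζ ∈ closedBall ζ0 |t|, gg (Complex.exp (ζ / 2)) ≠ 0 := by
      rw [abs_of_pos ht.1]
      intro ζ hζ
      exact H.g_ne (hmem ζ hζ) (Complex.exp_ne_zero _)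
    have hJ := han.circleAverage_log_norm_of_ne_zero hnz
    rw [H.U_eq hw, ← hJ]
    have hneg : -Real.circleAverage (fun ζ => Real.log ‖gg (Complex.exp (ζ / 2))‖) ζ0 t = Real.circleAverage (fun ζ => -Real.log ‖gg (Complex.exp (ζ / 2))‖) ζ0 t := by
      simp [Real.circleAverage_def]
    rw [hneg]
    apply Real.circleAverage_mono
    · apply ContinuousOn.circleIntegrable ht.1.le
      intro ζ hζ
      have hζ' := sphere_subset_closedBall hζ
      rw [← abs_of_pos ht.1] at hζ'
      have := (han ζ hζ').continuousAt.norm.log (by simpa using hnz ζ hζ')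
      exact this.neg.continuousWithinAt
    · exact (H.u_cont).continuousOn.circleIntegrable ht.1.le
    · intro ζ hζ
      rw [abs_of_pos ht.1] at hζ
      exact H.U_ge (hmem ζ (sphere_subset_closedBall hζ))
  · rw [H.U_zero hw]
    exact Real.circleAverage_nonneg_of_nonneg fun x _ => H.U_nonneg _

lemma norm_exp_half (s φ : ℝ) : ‖Complex.exp ((s + φ * Complex.I) / 2)‖ = Real.exp (s / 2) := by
  rw [Complex.norm_exp]; congr 1; simp

lemma u_zero : ∃ smax : ℝ, ∀ s φ : ℝ, smax ≤ s → UU F R1 (Complex.exp ((s + φ * Complex.I) / 2)) = 0 := by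
  obtain ⟨M, hM⟩ := H.compactC.isBounded.subset_closedBall 0
  refine ⟨2 * Real.log (|M| + 1), fun s φ hs => H.U_zero fun h => ?_⟩
  have := hM h
  rw [mem_closedBall_zero_iff, H.norm_exp_half] at this
  have h2 : |M| + 1 ≤ Real.exp (s / 2) := by
    rw [← Real.log_le_iff_le_exp (by positivity)]; linarith
  linarith [le_abs_self M]

lemma u_low (η : ℝ) (hη : 0 < η) : ∃ s1 : ℝ, ∀ s φ : ℝ, s ≤ s1 → UU F R1 (Complex.exp ((s + φ * Complex.I) / 2)) ≤ - s / 2 + η := by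
  have hd0 : HasDerivAt F 1 0 := by
    rw [← H.hder]; exact (H.hd.differentiableAt (isOpen_ball.mem_nhds H.zero_mem)).hasDerivAt
  have hlo := (hasDerivAt_iff_isLittleO.1 hd0).def (show 0 < Real.exp η - 1 by linarith [Real.add_one_lt_exp hη.ne'])
  simp only [sub_zero, H.F0, smul_eq_mul, mul_one] at hlo
  have hgc : Tendsto gg (𝓝 0) (𝓝 0) := by
    have : ContinuousAt gg 0 := H.gdiff.continuousOn.continuousAt (H.isOpenW.mem_nhds H.zeroW)
    rw [ContinuousAt, H.g0] at this; exact this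
  obtain ⟨r, hr, hball⟩ := Metric.mem_nhds_iff.1 (inter_mem (hgc.eventually hlo) (H.isOpenW.mem_nhds H.zeroW))
  refine ⟨min 0 (2 * Real.log (r / 2)), fun s φ hs => ?_⟩
  have hn := H.norm_exp_half s φ
  set w := Complex.exp ((s + φ * Complex.I) / 2) with hw
  have hw0 : w ≠ 0 := Complex.exp_ne_zero _
  have hs1 := hs.trans (min_le_left _ _)
  have hs2 := hs.trans (min_le_right _ _)
  have hwr : w ∈ ball (0:ℂ) r := by
    rw [mem_ball_zero_iff, hn]
    have : Real.exp (s / 2) ≤ r / 2 := by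
      rw [← Real.le_log_iff_exp_le (by positivity)]; linarith
    linarith
  obtain ⟨h1, h2⟩ := hball hwr
  have h1' : ‖F (gg w) - gg w‖ ≤ (Real.exp η - 1) * ‖gg w‖ := h1
  rw [H.Fg h2] at h1'
  have h3 : ‖w‖ ≤ Real.exp η * ‖gg w‖ := by
    have := norm_sub_norm_le w (gg w)
    linarith
  have hg : 0 < ‖gg w‖ := norm_pos_iff.2 (H.g_ne h2 hw0)
  have h4 := Real.log_le_log (norm_pos_iff.2 hw0) h3
  rw [hn, Real.log_exp, Real.log_mul (Real.exp_ne_zero _) hg.ne', Real.log_exp] at h4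
  rw [UU, if_pos h2]
  exact max_le (by linarith) (by linarith)

lemma disc_fill (R : ℝ) (hR : 0 < R) (hs : sphere (0:ℂ) R ⊆ F '' ball 0 R1) : closedBall (0:ℂ) R ⊆ F '' ball 0 R1 := by
  intro a ha
  by_contra hna
  have haR : a ∈ ball (0:ℂ) R := by
    rw [mem_ball]; refine lt_of_le_of_ne (mem_closedBall.1 ha) fun h => hna (hs h)
  have hne : ∀ z ∈ ball (0:ℂ) R1, F z - a ≠ 0 := fun z hz h => hna ⟨z, hz, sub_eq_zero.1 h⟩
  have hdd : DifferentiableOn ℂ (fun z => deriv F z / (F z - a)) (ball 0 R1) :=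
    (H.hd.deriv isOpen_ball).div (H.hd.sub_const a) hne
  obtain ⟨L, hL⟩ := hdd.isExactOn_ball
  have hz : (∮ w in C(0, R), (w - a)⁻¹) = 0 := by
    apply circleIntegral.integral_eq_zero_of_hasDerivWithinAt hR.le (f := fun w => L (gg w))
    intro w hw
    have hwW := hs hw
    have hgd : HasDerivAt gg (deriv gg w) w := (H.gdiff.differentiableAt (H.isOpenW.mem_nhds hwW)).hasDerivAt
    have hFd : HasDerivAt F (deriv F (gg w)) (gg w) := (H.hd.differentiableAt (isOpen_ball.mem_nhds (H.g_mem hwW))).hasDerivAt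
    have h1 : deriv F (gg w) * deriv gg w = 1 := by
      have hcomp := hFd.comp w hgd
      have hid : HasDerivAt (F ∘ gg) 1 w := (hasDerivAt_id w).congr_of_eventuallyEq (by
        filter_upwards [H.isOpenW.mem_nhds hwW] with y hy using H.Fg hy)
      exact hcomp.unique hid
    have h2 := (hL _ (H.g_mem hwW)).comp w hgd
    have h3 : deriv F (gg w) / (F (gg w) - a) * deriv gg w = (w - a)⁻¹ := by
      rw [H.Fg hwW, div_mul_eq_mul_div, h1, one_div]
    rw [h3] at h2
    exact h2.hasDerivWithinAt
  rw [circleIntegral.integral_sub_inv_of_mem_ball haR] at hz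
  simp [Real.pi_ne_zero, Complex.I_ne_zero] at hz

lemma u_alt (s : ℝ) : (∃ φ : ℝ, UU F R1 (Complex.exp ((s + φ * Complex.I) / 2)) = 0) ∨ ∫ φ in (-Real.pi)..Real.pi, UU F R1 (Complex.exp ((s + φ * Complex.I) / 2)) ≤ - Real.pi * s := by
  by_cases hex : ∃ φ : ℝ, UU F R1 (Complex.exp ((s + φ * Complex.I) / 2)) = 0
  · exact Or.inl hex
  right
  push Not at hex
  set R := Real.exp (s / 2) with hRd
  have hR : 0 < R := Real.exp_pos _
  have hs : sphere (0:ℂ) R ⊆ F '' closedBall 0 1 := by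
    intro w hw
    by_contra hn
    have hwn : ‖w‖ = R := by simpa using hw
    have := H.U_zero hn
    apply hex (2 * Complex.arg w)
    rw [← this]; congr 1
    rw [show ((s:ℂ) + (2 * Complex.arg w : ℝ) * Complex.I) / 2 = (s / 2 : ℝ) + Complex.arg w * Complex.I by push_cast; ring, Complex.exp_add, ← Complex.ofReal_exp, ← hRd, ← hwn, Complex.norm_mul_exp_arg_mul_I]
  have hfill := H.disc_fill R hR (hs.trans (image_mono H.sub1))
  rw [half_angle _ (fun w hw => H.U_cont hw) (fun w _ => H.U_even w)]
  set h := dslope gg 0 with hh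
  have hdW : DifferentiableOn ℂ h (F '' ball 0 R1) := (Complex.differentiableOn_dslope (H.isOpenW.mem_nhds H.zeroW)).2 H.gdiff
  have h00 : h 0 = 1 := by
    rw [hh, dslope_same]
    have hgd : HasDerivAt gg (deriv gg 0) (F 0) := by
      rw [H.F0]; exact (H.gdiff.differentiableAt (H.isOpenW.mem_nhds H.zeroW)).hasDerivAt
    have hFd : HasDerivAt F 1 0 := by
      rw [← H.hder]; exact (H.hd.differentiableAt (isOpen_ball.mem_nhds H.zero_mem)).hasDerivAt
    have hcomp := hgd.comp 0 hFd
    have hid : HasDerivAt (gg ∘ F) 1 0 := (hasDerivAt_id 0).congr_of_eventuallyEq (by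
        filter_upwards [isOpen_ball.mem_nhds H.zero_mem] with y hy using H.gF hy)
    have := hcomp.unique hid
    simpa using this
  have hval : ∀ w, w ≠ 0 → h w = gg w / w := by
    intro w hw
    rw [hh, dslope_of_ne _ hw, slope_def_field, H.g0]; simp
  have hnz : ∀ w ∈ F '' ball 0 R1, h w ≠ 0 := by
    intro w hw
    by_cases h0 : w = 0
    · rw [h0, h00]; exact one_ne_zero
    · rw [hval w h0]; exact div_ne_zero (H.g_ne hw h0) h0
  have hJ := AnalyticOnNhd.circleAverage_log_norm_of_ne_zero (R := R) (c := 0) (g := h) (by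
    rw [abs_of_pos hR]; intro w hw; exact hdW.analyticAt (H.isOpenW.mem_nhds (hfill hw))) (by
    rw [abs_of_pos hR]; intro w hw; exact hnz w (hfill hw))
  rw [h00, norm_one, Real.log_one] at hJ
  have hcong : Real.circleAverage (UU F R1) 0 R = Real.circleAverage (fun w => -(Real.log ‖h w‖) - s / 2) 0 R := by
    apply Real.circleAverage_congr_sphere
    intro w hw
    rw [abs_of_pos hR] at hw
    have hwn : ‖w‖ = R := by simpa using hw
    have hw0 : w ≠ 0 := by intro h; rw [h, norm_zero] at hwn; exact hR.ne hwn
    simp only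
    rw [H.U_eq (hs hw), hval w hw0, norm_div, Real.log_div (norm_ne_zero_iff.2 (H.g_ne (image_mono H.sub1 (hs hw)) hw0)) (norm_ne_zero_iff.2 hw0), hwn, hRd, Real.log_exp]
    ring
  have hci : CircleIntegrable (fun w => -(Real.log ‖h w‖)) 0 R := by
    apply ContinuousOn.circleIntegrable hR.le
    intro w hw
    have hwW := hfill (sphere_subset_closedBall hw)
    have := (hdW.continuousOn.continuousAt (H.isOpenW.mem_nhds hwW)).norm.log (by simpa using hnz w hwW)
    exact this.neg.continuousWithinAt
  have hneg : Real.circleAverage (fun w => -(Real.log ‖h w‖)) 0 R = - Real.circleAverage (fun w => (Real.log ‖h w‖)) 0 R := by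
    simp [Real.circleAverage_def]
  rw [hcong, Real.circleAverage_fun_sub hci (by simp), hneg, hJ, Real.circleAverage_const]
  linarith

end NiceF

end

section
open MeasureTheory Set Filter Topology Metric

noncomputable def KK (z : ℂ) : ℂ := z / (1 - z ^ 2)
noncomputable def VV (w : ℂ) : ℝ := Real.arcosh (‖(4 * w ^ 2)⁻¹‖ + ‖1 + (4 * w ^ 2)⁻¹‖) / 2

lemma arg_ge (X : ℂ) : 1 ≤ ‖X‖ + ‖1 + X‖ := by
  have := norm_sub_le (1 + X) X
  simp only [add_sub_cancel_right, norm_one] at this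
  linarith

lemma VK {z : ℂ} (h0 : z ≠ 0) (h1 : ‖z‖ ≤ 1) (h2 : z ^ 2 ≠ 1) : VV (KK z) = - Real.log ‖z‖ := by
  have hz : 1 - z ^ 2 ≠ 0 := fun h => h2 (by linear_combination -h)
  have hX : (4 * (KK z) ^ 2)⁻¹ = (1 - z ^ 2) ^ 2 / (4 * z ^ 2) := by
    rw [KK]; field_simp
  have hX1 : 1 + (4 * (KK z) ^ 2)⁻¹ = (1 + z ^ 2) ^ 2 / (4 * z ^ 2) := by
    rw [hX]; field_simp; ring
  have hn : 0 < ‖z‖ := norm_pos_iff.2 h0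
  have hp := parallelogram_law_with_norm ℝ (1:ℂ) (z ^ 2)
  have hc : ‖(4 * (KK z) ^ 2)⁻¹‖ + ‖1 + (4 * (KK z) ^ 2)⁻¹‖ = Real.cosh (2 * (- Real.log ‖z‖)) := by
    rw [hX1, hX, norm_div, norm_div, norm_pow, norm_pow, norm_mul, norm_pow, Real.cosh_eq]
    have e1 : Real.exp (2 * (- Real.log ‖z‖)) = (‖z‖ ^ 2)⁻¹ := by
      rw [show 2 * (- Real.log ‖z‖) = - (Real.log (‖z‖ ^ 2)) by rw [Real.log_pow]; push_cast; ring, Real.exp_neg, Real.exp_log (by positivity)]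
    rw [Real.exp_neg, e1]
    rw [norm_one, norm_pow] at hp
    rw [inv_inv, Complex.norm_ofNat]
    field_simp
    linear_combination 2 * hp
  have hl : 0 ≤ - Real.log ‖z‖ := by linarith [Real.log_nonpos hn.le h1]
  rw [VV, hc, Real.arcosh_cosh (by linarith)]
  ring

lemma K_surj {w : ℂ} (hw : w ≠ 0) : ∃ z, z ≠ 0 ∧ ‖z‖ ≤ 1 ∧ z ^ 2 ≠ 1 ∧ KK z = w := by
  have key : ∃ z : ℂ, w * z ^ 2 + z - w = 0 ∧ ‖z‖ ≤ 1 := by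
    obtain ⟨d, hd⟩ := IsAlgClosed.exists_pow_nat_eq (1 + 4 * w ^ 2) (n := 2) (by norm_num)
    have hz : w * ((-1 + d) / (2 * w)) ^ 2 + (-1 + d) / (2 * w) - w = 0 := by
      field_simp
      linear_combination hd
    set z := (-1 + d) / (2 * w) with hzd
    by_cases h : ‖z‖ ≤ 1
    · exact ⟨z, hz, h⟩
    · have hz0 : z ≠ 0 := by rintro h0; rw [h0] at h; simp at h
      refine ⟨-z⁻¹, ?_, ?_⟩
      · field_simp
        linear_combination -hz
      · rw [norm_neg, norm_inv]
        exact inv_le_one_of_one_le₀ (not_le.1 h).le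
  obtain ⟨z, hz, h1⟩ := key
  have h0 : z ≠ 0 := by rintro rfl; apply hw; simpa using hz
  have h2 : z ^ 2 ≠ 1 := by
    intro h; apply h0; rw [h] at hz; linear_combination hz
  refine ⟨z, h0, h1, h2, ?_⟩
  have hz' : 1 - z ^ 2 ≠ 0 := fun h => h2 (by linear_combination -h)
  rw [KK, div_eq_iff hz']
  linear_combination hz

lemma K_re {z : ℂ} (h1 : ‖z‖ = 1) : (KK z).re = 0 := by
  have h0 : z ≠ 0 := by rintro rfl; simp at h1
  have hc : z⁻¹ = (starRingEnd ℂ) z := Complex.inv_eq_conj h1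
  have : KK z = (z⁻¹ - z)⁻¹ := by
    rw [KK]
    by_cases h : 1 - z ^ 2 = 0
    · rw [h, show z⁻¹ - z = 0 by field_simp; simpa using h]; simp
    · rw [show z⁻¹ - z = (1 - z ^ 2) / z by field_simp, inv_div]
  rw [this, hc, Complex.inv_re]
  simp

lemma one_sub_sq_ne {z : ℂ} (hz : z ∈ ball (0:ℂ) 1) : 1 - z ^ 2 ≠ 0 := by
  intro h
  rw [mem_ball_zero_iff] at hz
  have : ‖z ^ 2‖ = 1 := by rw [show z ^ 2 = 1 by linear_combination -h]; simp
  rw [norm_pow] at this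
  nlinarith [norm_nonneg z]

lemma K_inj : InjOn KK (ball 0 1) := by
  intro z hz w hw h
  have h1 := one_sub_sq_ne hz
  have h2 := one_sub_sq_ne hw
  rw [KK, KK, div_eq_div_iff h1 h2] at h
  have h3 : (z - w) * (1 + z * w) = 0 := by linear_combination h
  rcases mul_eq_zero.1 h3 with h4 | h4
  · linear_combination h4
  · exfalso
    rw [mem_ball_zero_iff] at hz hw
    have : ‖z * w‖ = 1 := by rw [show z * w = -1 by linear_combination h4]; simp
    rw [norm_mul] at this
    nlinarith [norm_nonneg z, norm_nonneg w]

lemma K_diff : DifferentiableOn ℂ KK (ball 0 1) := by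
  intro z hz
  have := one_sub_sq_ne hz
  unfold KK
  fun_prop (disch := assumption)

lemma K_img {w : ℂ} (hw : 0 < w.re) : ∃ z ∈ ball (0:ℂ) 1, z ≠ 0 ∧ KK z = w ∧ VV w = - Real.log ‖z‖ := by
  obtain ⟨z, h0, h1, h2, h3⟩ := K_surj (w := w) (by rintro rfl; simp at hw)
  refine ⟨z, ?_, h0, h3, ?_⟩
  · rw [mem_ball_zero_iff]
    refine lt_of_le_of_ne h1 fun h => ?_
    have := K_re h
    rw [h3] at this; exact hw.ne' this
  · rw [← h3, VK h0 h1 h2]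

lemma v_form (ζ : ℂ) : VV (Complex.exp (ζ / 2)) = Real.arcosh (‖Complex.exp (-ζ) / 4‖ + ‖1 + Complex.exp (-ζ) / 4‖) / 2 := by
  rw [VV]
  have : (4 * Complex.exp (ζ / 2) ^ 2)⁻¹ = Complex.exp (-ζ) / 4 := by
    rw [← Complex.exp_nat_mul, mul_inv, ← Complex.exp_neg]
    push_cast
    rw [show -(2 * (ζ / 2)) = -ζ by ring]; ring
  rw [this]

lemma v_cont : Continuous fun ζ : ℂ => VV (Complex.exp (ζ / 2)) := by
  simp_rw [v_form]
  apply Continuous.div_const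
  apply Real.continuousOn_arcosh.comp_continuous
  · fun_prop
  · intro x; exact arg_ge _

lemma v_nonneg (w : ℂ) : 0 ≤ VV w := by
  rw [VV]; have := Real.arcosh_nonneg (arg_ge (4 * w ^ 2)⁻¹); positivity

lemma norm_X (s φ : ℝ) : ‖Complex.exp (-(s + φ * Complex.I)) / 4‖ = Real.exp (-s) / 4 := by
  rw [norm_div, Complex.norm_exp]; simp
lemma norm_X1 (s φ : ℝ) : ‖1 + Complex.exp (-(s + φ * Complex.I)) / 4‖ = Real.sqrt (1 + Real.exp (-s) / 2 * Real.cos φ + (Real.exp (-s) / 4) ^ 2) := by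
  rw [Complex.norm_def]
  congr 1
  have h : Complex.exp (-(s + φ * Complex.I)) = (Real.exp (-s) : ℝ) * ((Real.cos φ : ℝ) - (Real.sin φ : ℝ) * Complex.I) := by
    rw [neg_add, Complex.exp_add, ← neg_mul, Complex.exp_mul_I, Complex.cos_neg, Complex.sin_neg]
    push_cast; ring
  have g : ∀ e c d : ℝ, Complex.normSq (1 + (e:ℂ) * ((c:ℂ) - (d:ℂ) * Complex.I) / 4) = (1 + e * c / 4) ^ 2 + (e * d / 4) ^ 2 := by
    intro e c d
    rw [Complex.normSq_apply]; simp; ring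
  rw [h, g]
  have := Real.sin_sq_add_cos_sq φ
  linear_combination (Real.exp (-s) ^ 2 / 16) * this

lemma v_even (s φ : ℝ) : VV (Complex.exp ((s + (-φ : ℝ) * Complex.I) / 2)) = VV (Complex.exp ((s + φ * Complex.I) / 2)) := by
  rw [v_form, v_form, norm_X, norm_X, norm_X1, norm_X1, Real.cos_neg]

lemma v_mono (s a b : ℝ) (h0 : 0 ≤ a) (hab : a ≤ b) (hb : b ≤ Real.pi) : VV (Complex.exp ((s + b * Complex.I) / 2)) ≤ VV (Complex.exp ((s + a * Complex.I) / 2)) := by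
  rw [v_form, v_form]
  refine div_le_div_of_nonneg_right ?_ (by norm_num)
  rw [Real.arcosh_le_arcosh (by linarith [arg_ge (Complex.exp (-(s + b * Complex.I)) / 4)]) (by linarith [arg_ge (Complex.exp (-(s + a * Complex.I)) / 4)])]
  rw [norm_X, norm_X, norm_X1, norm_X1]
  have := Real.cos_le_cos_of_nonneg_of_le_pi h0 hb hab
  gcongr

lemma v_low (η : ℝ) (hη : 0 < η) : ∃ s1 : ℝ, ∀ s φ : ℝ, s ≤ s1 → - s / 2 - η ≤ VV (Complex.exp ((s + φ * Complex.I) / 2)) := by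
  have hq : 0 < 1 - Real.exp (-(2 * η)) := by
    have : Real.exp (-(2*η)) < 1 := by rw [Real.exp_lt_one_iff]; linarith
    linarith
  refine ⟨- Real.log (3 / (1 - Real.exp (-(2 * η)))), fun s φ hs => ?_⟩
  rw [v_form]
  set X := Complex.exp (-(s + φ * Complex.I)) / 4 with hX
  have hn := norm_X s φ
  rw [← hX] at hn
  have h1 := arg_ge X
  set x := ‖X‖ + ‖1 + X‖ with hx
  have hx2 : Real.exp (-s) / 2 - 1 ≤ x := by
    have := norm_sub_le (1 + X) 1
    rw [add_sub_cancel_left, norm_one] at this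
    linarith
  have h3 : x - 1 ≤ √(x ^ 2 - 1) := by
    apply Real.le_sqrt_of_sq_le; nlinarith
  have h4 : 3 / (1 - Real.exp (-(2 * η))) ≤ Real.exp (-s) := by
    rw [← Real.log_le_iff_le_exp (by positivity)]; linarith
  rw [div_le_iff₀ hq] at h4
  have h5 : Real.exp (-s - 2 * η) ≤ Real.exp (Real.arcosh x) := by
    rw [Real.exp_arcosh h1, show -s - 2 * η = -s + -(2 * η) by ring, Real.exp_add]
    linarith
  rw [Real.exp_le_exp] at h5
  linarith

lemma v_harm (ζ : ℂ) (t : ℝ) (ht : 0 < t) (hst : |ζ.im| + t < Real.pi) :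
    Real.circleAverage (fun ζ : ℂ => VV (Complex.exp (ζ / 2))) ζ t = VV (Complex.exp (ζ / 2)) := by
  have hW := inj_image_open isOpen_ball K_diff K_inj
  have hG := inv_diff isOpen_ball K_diff K_inj
  set G := Function.invFunOn KK (ball 0 1) with hGd
  have hre : ∀ x ∈ closedBall ζ t, 0 < (Complex.exp (x / 2)).re := by
    intro x hx
    rw [Complex.exp_re]
    refine mul_pos (Real.exp_pos _) (Real.cos_pos_of_mem_Ioo ?_)
    have h1 : |(x - ζ).im| ≤ t := (Complex.abs_im_le_norm _).trans (by rwa [mem_closedBall, dist_eq_norm] at hx)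
    rw [Complex.sub_im] at h1
    have e : (x / 2).im = x.im / 2 := by simp
    rw [e]
    have := abs_le.1 h1
    have h3 := le_abs_self ζ.im
    have h4 := neg_abs_le ζ.im
    constructor <;> linarith [this.1, this.2]
  have hmem : ∀ x ∈ closedBall ζ t, Complex.exp (x / 2) ∈ KK '' ball 0 1 ∧ G (Complex.exp (x / 2)) ≠ 0 ∧ VV (Complex.exp (x / 2)) = - Real.log ‖G (Complex.exp (x / 2))‖ := by
    intro x hx
    obtain ⟨z, hz, h0, h1, h2⟩ := K_img (hre x hx)
    have : G (Complex.exp (x / 2)) = z := by rw [← h1]; exact K_inj.leftInvOn_invFunOn hz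
    exact ⟨⟨z, hz, h1⟩, by rw [this]; exact h0, by rw [this, h2]⟩
  have hJ := AnalyticOnNhd.circleAverage_log_norm_of_ne_zero (R := t) (c := ζ) (g := fun x => G (Complex.exp (x / 2))) (by
    rw [abs_of_pos ht]; intro w hw
    have h1 : AnalyticAt ℂ G (Complex.exp (w / 2)) := hG.analyticAt (hW.mem_nhds (hmem w hw).1)
    exact AnalyticAt.fun_comp h1 (by fun_prop)) (by
    rw [abs_of_pos ht]; intro w hw; exact (hmem w hw).2.1)
  have hc : Real.circleAverage (fun ζ : ℂ => VV (Complex.exp (ζ / 2))) ζ t = Real.circleAverage (fun x => - Real.log ‖G (Complex.exp (x / 2))‖) ζ t := by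
    apply Real.circleAverage_congr_sphere
    intro w hw
    rw [abs_of_pos ht] at hw
    exact (hmem w (sphere_subset_closedBall hw)).2.2
  have hneg : Real.circleAverage (fun x => - Real.log ‖G (Complex.exp (x / 2))‖) ζ t = - Real.circleAverage (fun x => Real.log ‖G (Complex.exp (x / 2))‖) ζ t := by
    simp [Real.circleAverage_def]
  rw [hc, hneg, hJ, (hmem ζ (mem_closedBall_self ht.le)).2.2]

noncomputable def PP : ℕ → Polynomial ℂ
  | 0 => 2
  | 1 => 1
  | (n+2) => PP (n+1) + Polynomial.X * PP n

lemma PP_eval (y1 y2 t : ℂ) (hs : y1 + y2 = 1) (hp : y1 * y2 = -t) : ∀ n, (PP n).eval t = y1 ^ n + y2 ^ n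
  | 0 => by simp [PP]; norm_num
  | 1 => by simp [PP, hs]
  | (n+2) => by
    rw [PP, Polynomial.eval_add, Polynomial.eval_mul, Polynomial.eval_X, PP_eval y1 y2 t hs hp (n+1), PP_eval y1 y2 t hs hp n]
    linear_combination (-(y1 ^ (n+1) + y2 ^ (n+1))) * hs + (y1^n + y2^n) * hp

lemma PP_zero : ∀ n, 1 ≤ n → (PP n).eval 0 = 1 := by
  intro n hn
  rw [PP_eval 1 0 0 (by simp) (by simp)]
  simp; omega

lemma v_per (s : ℝ) : Function.Periodic (fun φ : ℝ => VV (Complex.exp ((s + φ * Complex.I) / 2))) (2 * Real.pi) := by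
  intro φ
  simp only
  rw [v_form, v_form, norm_X, norm_X, norm_X1, norm_X1, Real.cos_add_two_pi]

lemma PP_bound (n : ℕ) (s φ : ℝ) : ‖(PP n).eval (Complex.exp (s + φ * Complex.I))‖ ≤ 2 * Real.exp (n * (s / 2 + VV (Complex.exp ((s + φ * Complex.I) / 2)))) := by
  set w := Complex.exp ((s + φ * Complex.I) / 2) with hw
  have hw0 : w ≠ 0 := Complex.exp_ne_zero _
  have hwn : ‖w‖ = Real.exp (s / 2) := by
    rw [hw, Complex.norm_exp]; congr 1; simp
  have hw2 : Complex.exp (s + φ * Complex.I) = w ^ 2 := by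
    rw [hw, ← Complex.exp_nat_mul]; congr 1; push_cast; ring
  obtain ⟨z, h0, h1, h2, h3⟩ := K_surj hw0
  have hz : 1 - z ^ 2 ≠ 0 := fun h => h2 (by linear_combination -h)
  have hzn : 0 < ‖z‖ := norm_pos_iff.2 h0
  have hy1 : ‖w / z‖ = Real.exp (s / 2 + VV w) := by
    rw [← h3, VK h0 h1 h2, h3, norm_div, hwn, Real.exp_add, Real.exp_neg, Real.exp_log hzn]; rfl
  have hy2 : ‖-(w * z)‖ ≤ ‖w / z‖ := by
    rw [norm_neg, norm_mul, norm_div, div_eq_mul_inv]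
    gcongr
    exact h1.trans (one_le_inv_iff₀.2 ⟨hzn, h1⟩)
  rw [hw2, PP_eval (w / z) (-(w * z)) (w ^ 2) (by
    rw [← h3, KK]; field_simp; ring) (by field_simp), mul_comm (n:ℝ), Real.exp_mul, Real.rpow_natCast, ← hy1]
  calc _ ≤ ‖(w / z) ^ n‖ + ‖(-(w*z)) ^ n‖ := norm_add_le _ _
    _ = ‖w/z‖ ^ n + ‖-(w*z)‖ ^ n := by rw [norm_pow, norm_pow]
    _ ≤ ‖w/z‖ ^ n + ‖w/z‖ ^ n := by gcongr
    _ = _ := by ring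

lemma v_int (s : ℝ) : - Real.pi * s ≤ ∫ φ in (-Real.pi)..Real.pi, VV (Complex.exp ((s + φ * Complex.I) / 2)) := by
  set J := ∫ φ in (-Real.pi)..Real.pi, VV (Complex.exp ((s + φ * Complex.I) / 2)) with hJ
  have hJ' : J = ∫ φ in (0:ℝ)..(2 * Real.pi), VV (Complex.exp ((s + φ * Complex.I) / 2)) := by
    have := (v_per s).intervalIntegral_add_eq (-Real.pi) 0
    rw [show -Real.pi + 2 * Real.pi = Real.pi by ring, zero_add] at this
    exact this
  have hcv : Continuous fun φ : ℝ => VV (Complex.exp ((s + φ * Complex.I) / 2)) :=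
    v_cont.comp (f := fun φ : ℝ => (s:ℂ) + φ * Complex.I) (by fun_prop)
  have key : ∀ n : ℕ, 1 ≤ n → 0 ≤ 2 * Real.pi * Real.log 2 + n * (Real.pi * s + J) := by
    intro n hn
    set Q : Polynomial ℂ := (PP n).comp (Polynomial.C (Complex.exp s) * Polynomial.X) with hQ
    have hQe : ∀ x, Q.eval x = (PP n).eval (Complex.exp s * x) := by intro x; simp [hQ]
    have hQ0 : Q.coeff 0 = 1 := by
      rw [Polynomial.coeff_zero_eq_eval_zero, hQe, mul_zero, PP_zero n hn]
    have hQne : Q ≠ 0 := by intro h; rw [h] at hQ0; simp at hQ0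
    have h1 := Polynomial.norm_coeff_le_choose_mul_mahlerMeasure 0 Q
    rw [hQ0, norm_one, Nat.choose_zero_right, Nat.cast_one, one_mul] at h1
    have h2 : 0 ≤ Q.logMahlerMeasure := by
      rw [Polynomial.logMahlerMeasure_eq_log_MahlerMeasure]; exact Real.log_nonneg h1
    rw [Polynomial.logMahlerMeasure_def, Real.circleAverage_def, smul_eq_mul] at h2
    have h3 : 0 ≤ ∫ θ in (0:ℝ)..2 * Real.pi, Real.log ‖Q.eval (circleMap 0 1 θ)‖ :=
      nonneg_of_mul_nonneg_right h2 (by positivity)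
    have h4 : ∫ θ in (0:ℝ)..2 * Real.pi, Real.log ‖Q.eval (circleMap 0 1 θ)‖ ≤ ∫ θ in (0:ℝ)..2 * Real.pi, (Real.log 2 + n * (s / 2 + VV (Complex.exp ((s + θ * Complex.I) / 2)))) := by
      apply intervalIntegral.integral_mono_ae Real.two_pi_pos.le
      · exact Polynomial.intervalIntegrable_mahlerMeasure Q
      · exact Continuous.intervalIntegrable (by fun_prop) _ _
      · have hcount : (circleMap 0 1 ⁻¹' (Q.roots.toFinset : Set ℂ)).Countable :=
          (Finset.countable_toSet _).preimage_circleMap _ one_ne_zero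
        have := hcount.ae_notMem volume
        filter_upwards [this] with θ hθ
        have hne : Q.eval (circleMap 0 1 θ) ≠ 0 := by
          intro h; apply hθ
          simp [hQne, h]
        have hb := PP_bound n s θ
        rw [Complex.exp_add] at hb
        have hcm : circleMap 0 1 θ = Complex.exp (θ * Complex.I) := by simp [circleMap]
        rw [← hcm, ← hQe] at hb
        have := Real.log_le_log (norm_pos_iff.2 hne) hb
        rwa [Real.log_mul two_ne_zero (Real.exp_ne_zero _), Real.log_exp] at this
    have h5 := h3.trans h4
    rw [intervalIntegral.integral_add (by simp) (Continuous.intervalIntegrable (by fun_prop) _ _), intervalIntegral.integral_const_mul, intervalIntegral.integral_add (by simp) (hcv.intervalIntegrable _ _), ← hJ', intervalIntegral.integral_const, intervalIntegral.integral_const] at h5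
    simp only [smul_eq_mul, sub_zero] at h5
    linarith
  by_contra hlt
  push Not at hlt
  obtain ⟨n, hn⟩ := exists_nat_gt (2 * Real.pi * Real.log 2 / (-(Real.pi * s + J)))
  have hpos : 0 < -(Real.pi * s + J) := by linarith
  rw [div_lt_iff₀ hpos] at hn
  have := key (n+1) (by omega)
  push_cast at this
  nlinarith

end

section
open MeasureTheory Set Filter Topology Metric

lemma NiceF.compHyp {F : ℂ → ℂ} {R1 : ℝ} (H : NiceF F R1) : CompHyp (fun ζ => UU F R1 (Complex.exp (ζ / 2))) (fun ζ => VV (Complex.exp (ζ / 2))) where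
  hu := H.u_cont
  hu0 := fun _ => H.U_nonneg _
  hup := H.u_per
  hsub := H.u_sub
  huz := H.u_zero
  hul := H.u_low
  hualt := H.u_alt
  hv := v_cont
  hv0 := fun _ => v_nonneg _
  hev := v_even
  hmono := v_mono
  hh := v_harm
  hvl := v_low
  hvint := v_int

lemma VV_cont {w : ℂ} (hw : w ≠ 0) : ContinuousAt VV w := by
  have : ContinuousOn VV {0}ᶜ := by
    unfold VV
    apply ContinuousOn.div_const
    refine ContinuousOn.comp (g := Real.arcosh) (f := fun w : ℂ => ‖(4 * w ^ 2)⁻¹‖ + ‖1 + (4 * w ^ 2)⁻¹‖) (t := Ici 1) Real.continuousOn_arcosh ?_ (fun x _ => arg_ge _)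
    have : ContinuousOn (fun w : ℂ => (4 * w ^ 2)⁻¹) {0}ᶜ := by
      apply ContinuousOn.inv₀ (by fun_prop)
      intro x hx; simpa using hx
    exact this.norm.add (this.const_add 1).norm
  exact this.continuousAt (isOpen_compl_singleton.mem_nhds hw)

lemma VV_even (w : ℂ) : VV (-w) = VV w := by simp [VV]

lemma meas_of_cont {W : ℂ → ℝ} (h : ∀ w, w ≠ 0 → ContinuousAt W w) : Measurable W :=
  measurable_of_continuousOn_compl_singleton 0 (fun w hw => (h w hw).continuousWithinAt)

lemma polar_lint (g : ℂ → ENNReal) (hg : Measurable g) :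
    ∫⁻ w, g w = ∫⁻ ρ in Ioi (0:ℝ), ENNReal.ofReal ρ * ∫⁻ θ in Ioo (-Real.pi) Real.pi, g (ρ * Complex.exp (θ * Complex.I)) := by
  rw [← Complex.lintegral_comp_polarCoord_symm, polarCoord_target, Measure.volume_eq_prod, ← Measure.prod_restrict, lintegral_prod]
  · apply lintegral_congr
    intro ρ
    rw [← lintegral_const_mul _ (by fun_prop)]
    apply lintegral_congr
    intro θ
    rw [smul_eq_mul, Complex.polarCoord_symm_apply, Complex.exp_mul_I]
    simp
  · apply Measurable.aemeasurable
    simp only [Complex.polarCoord_symm_apply, smul_eq_mul]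
    fun_prop

lemma circ_lint (W : ℂ → ℝ) (hW : ∀ w, w ≠ 0 → ContinuousAt W w) (hev : ∀ w, W (-w) = W w) (c ρ : ℝ) (hρ : 0 < ρ) :
    ∫⁻ θ in Ioo (-Real.pi) Real.pi, ENNReal.ofReal (W (ρ * Complex.exp (θ * Complex.I)) - c) =
      ENNReal.ofReal (∫ φ in (-Real.pi)..Real.pi, max (W (Complex.exp (((2 * Real.log ρ : ℝ) + φ * Complex.I) / 2)) - c) 0) := by
  have hpi := Real.pi_pos
  rw [half_angle (fun w => max (W w - c) 0) (fun w hw => ((hW w hw).sub continuousAt_const).max continuousAt_const) (fun w _ => by simp only [hev]), show 2 * Real.log ρ / 2 = Real.log ρ by ring, Real.exp_log hρ, Real.circleAverage_def, smul_eq_mul, ← mul_assoc, mul_inv_cancel₀ (by positivity), one_mul]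
  have hper := ((periodic_circleMap 0 ρ).comp (fun w => max (W w - c) 0)).intervalIntegral_add_eq 0 (-Real.pi)
  rw [show -Real.pi + 2 * Real.pi = Real.pi by ring, zero_add] at hper
  simp only [Function.comp_def] at hper
  have hcont : Continuous fun θ => max (W (circleMap 0 ρ θ) - c) 0 := by
    rw [continuous_iff_continuousAt]; intro θ
    have h0 : circleMap 0 ρ θ ≠ 0 := by simp [circleMap, hρ.ne']
    have h1 : ContinuousAt (fun θ => W (circleMap 0 ρ θ)) θ := ContinuousAt.comp (hW _ h0) (continuous_circleMap 0 ρ).continuousAt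
    exact (h1.sub continuousAt_const).max continuousAt_const
  rw [hper, intervalIntegral.integral_of_le (by linarith), integral_Ioc_eq_integral_Ioo, ofReal_integral_eq_lintegral_ofReal]
  · apply lintegral_congr
    intro θ
    rw [circleMap, zero_add]
    rcases le_total 0 (W (ρ * Complex.exp (θ * Complex.I)) - c) with h | h
    · rw [max_eq_left h]
    · rw [max_eq_right h, ENNReal.ofReal_of_nonpos h, ENNReal.ofReal_zero]
  · exact (hcont.integrableOn_Icc (a := -Real.pi) (b := Real.pi)).mono_set Ioo_subset_Icc_self
  · exact Eventually.of_forall fun θ => le_max_right _ _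

theorem area_comparison {F : ℂ → ℂ} {R1 : ℝ} (H : NiceF F R1) (c : ℝ) (hc : 0 ≤ c) :
    ∫⁻ w, ENNReal.ofReal (UU F R1 w - c) ≤ ∫⁻ w, ENNReal.ofReal (VV w - c) := by
  have hU : ∀ w, w ≠ 0 → ContinuousAt (UU F R1) w := fun w hw => H.U_cont hw
  have hV : ∀ w, w ≠ 0 → ContinuousAt VV w := fun w hw => VV_cont hw
  have mU := meas_of_cont hU
  have mV := meas_of_cont hV
  rw [polar_lint _ (by fun_prop), polar_lint _ (by fun_prop)]
  apply setLIntegral_mono' measurableSet_Ioi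
  intro ρ hρ
  gcongr 1
  rw [circ_lint _ hU H.U_even c ρ hρ, circ_lint _ hV VV_even c ρ hρ]
  exact ENNReal.ofReal_le_ofReal (comparison H.compHyp _ c hc)

end

section
open MeasureTheory Set Filter Topology Metric

lemma exp_orth (j k : ℕ) : ∫ θ in (-Real.pi)..Real.pi, Complex.exp (θ * Complex.I) ^ (2 * j) * (starRingEnd ℂ) (Complex.exp (θ * Complex.I) ^ (2 * k)) = if j = k then (2 * Real.pi : ℂ) else 0 := by
  have h : ∀ θ : ℝ, Complex.exp (θ * Complex.I) ^ (2 * j) * (starRingEnd ℂ) (Complex.exp (θ * Complex.I) ^ (2 * k)) = Complex.exp ((2 * ((j:ℂ) - k) * Complex.I) * θ) := by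
    intro θ
    rw [map_pow, ← Complex.exp_conj, ← Complex.exp_nat_mul, ← Complex.exp_nat_mul, ← Complex.exp_add]
    congr 1
    simp
    ring
  simp_rw [h]
  split_ifs with hjk
  · subst hjk; simp; ring
  · have hne : (j:ℂ) - k ≠ 0 := sub_ne_zero.2 (by exact_mod_cast hjk)
    rw [integral_exp_mul_complex (by simp [hne])]
    have : Complex.exp (2 * ((j:ℂ) - k) * Complex.I * Real.pi) = Complex.exp (2 * ((j:ℂ) - k) * Complex.I * (-Real.pi : ℝ)) := by
      rw [Complex.exp_eq_exp_iff_exists_int]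
      refine ⟨2 * ((j:ℤ) - k), ?_⟩
      push_cast; ring
    rw [this, sub_self, zero_div]

lemma parseval (d : ℕ → ℂ) (hd : Summable fun k => ‖d k‖) (g : ℝ → ℂ) (hg : ∀ θ : ℝ, HasSum (fun k => d k * Complex.exp (θ * Complex.I) ^ (2 * k)) (g θ)) :
    HasSum (fun k => 2 * Real.pi * ‖d k‖ ^ 2) (∫ θ in (-Real.pi)..Real.pi, ‖g θ‖ ^ 2) := by
  have hn1 : ∀ (θ : ℝ) (n : ℕ), ‖Complex.exp (θ * Complex.I) ^ n‖ = 1 := by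
    intro θ n; rw [norm_pow, Complex.norm_exp_ofReal_mul_I, one_pow]
  have hgc : Continuous g := by
    have : g = fun θ : ℝ => ∑' k, d k * Complex.exp (θ * Complex.I) ^ (2 * k) := by
      ext θ; exact (hg θ).tsum_eq.symm
    rw [this]
    refine continuous_tsum (fun k => by fun_prop) hd (fun k θ => ?_)
    rw [norm_mul, hn1, mul_one]
  -- coefficient
  have hcoef : ∀ k, ∫ θ in (-Real.pi)..Real.pi, g θ * (starRingEnd ℂ) (Complex.exp (θ * Complex.I) ^ (2 * k)) = 2 * Real.pi * d k := by
    intro k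
    have := intervalIntegral.hasSum_integral_of_dominated_convergence (μ := volume) (a := -Real.pi) (b := Real.pi) (F := fun j (θ:ℝ) => (d j * Complex.exp (θ * Complex.I) ^ (2 * j)) * (starRingEnd ℂ) (Complex.exp (θ * Complex.I) ^ (2 * k))) (f := fun θ => g θ * (starRingEnd ℂ) (Complex.exp (θ * Complex.I) ^ (2 * k))) (fun j _ => ‖d j‖)
      (fun j => (Continuous.aestronglyMeasurable (by fun_prop)))
      (fun j => Eventually.of_forall fun θ _ => by rw [norm_mul, norm_mul, RCLike.norm_conj, hn1, hn1, mul_one, mul_one])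
      (Eventually.of_forall fun θ _ => hd) (by simp)
      (Eventually.of_forall fun θ _ => (hg θ).mul_right _)
    simp only [mul_assoc, intervalIntegral.integral_const_mul, exp_orth] at this
    have h2 := this.tsum_eq
    rw [tsum_eq_single k (by intro j hj; rw [if_neg hj, mul_zero]), if_pos rfl] at h2
    rw [← h2]; push_cast; ring
  have hmain := intervalIntegral.hasSum_integral_of_dominated_convergence (μ := volume) (a := -Real.pi) (b := Real.pi) (F := fun j (θ:ℝ) => g θ * (starRingEnd ℂ) (d j * Complex.exp (θ * Complex.I) ^ (2 * j))) (f := fun θ => g θ * (starRingEnd ℂ) (g θ)) (fun j θ => ‖g θ‖ * ‖d j‖)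
      (fun j => (Continuous.aestronglyMeasurable (by fun_prop)))
      (fun j => Eventually.of_forall fun θ _ => by rw [norm_mul, RCLike.norm_conj, norm_mul, hn1, mul_one])
      (Eventually.of_forall fun θ _ => hd.mul_left _) (by
        simp_rw [tsum_mul_left]
        exact Continuous.intervalIntegrable (by fun_prop) _ _)
      (Eventually.of_forall fun θ _ => by
        have := ((Complex.hasSum_conj' (f := fun k => d k * Complex.exp (θ * Complex.I) ^ (2 * k))).2 (by simpa using hg θ))
        exact HasSum.mul_left _ this)
  have e1 : ∀ j, ∫ θ in (-Real.pi)..Real.pi, g θ * (starRingEnd ℂ) (d j * Complex.exp (θ * Complex.I) ^ (2 * j)) = ((2 * Real.pi * ‖d j‖ ^ 2 : ℝ) : ℂ) := by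
    intro j
    have : ∀ θ : ℝ, g θ * (starRingEnd ℂ) (d j * Complex.exp (θ * Complex.I) ^ (2 * j)) = (starRingEnd ℂ) (d j) * (g θ * (starRingEnd ℂ) (Complex.exp (θ * Complex.I) ^ (2 * j))) := by
      intro θ; rw [map_mul]; ring
    simp_rw [this]
    rw [intervalIntegral.integral_const_mul, hcoef]
    push_cast
    rw [← Complex.mul_conj']; ring
  have e2 : ∫ θ in (-Real.pi)..Real.pi, g θ * (starRingEnd ℂ) (g θ) = ((∫ θ in (-Real.pi)..Real.pi, ‖g θ‖ ^ 2 : ℝ) : ℂ) := by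
    rw [← intervalIntegral.integral_ofReal]
    congr 1; ext θ; rw [Complex.mul_conj']; push_cast; rfl
  simp only [e1, e2] at hmain
  exact_mod_cast hmain

lemma int_rlog (n : ℕ) (r : ℝ) (hr : 0 < r) : ∫⁻ ρ in Ioo 0 r, ENNReal.ofReal (ρ ^ (n+1) * Real.log (r / ρ)) = ENNReal.ofReal (r ^ (n+2) / (n+2) ^ 2) := by
  have hnn : ∀ ρ ∈ Ioo 0 r, 0 ≤ ρ ^ (n+1) * Real.log (r / ρ) := by
    intro ρ hρ
    exact mul_nonneg (pow_nonneg hρ.1.le _) (Real.log_nonneg (by rw [le_div_iff₀ hρ.1]; linarith [hρ.2]))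
  set P : ℝ → ℝ := fun ρ => ρ ^ (n+2) / (n+2) * (Real.log r) - (ρ ^ (n+1) * (ρ * Real.log ρ)) / (n+2) + ρ ^ (n+2) / (n+2) ^ 2 with hP
  have hPc : Continuous P := by
    have := Real.continuous_mul_log
    fun_prop
  have hn : (n:ℝ) + 2 ≠ 0 := by positivity
  have hder : ∀ ρ ∈ Ioo 0 r, HasDerivAt P (ρ ^ (n+1) * Real.log (r / ρ)) ρ := by
    intro ρ hρ
    have h1 := hasDerivAt_pow (n+2) ρ
    have h2 := Real.hasDerivAt_log hρ.1.ne'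
    have h3 := (((h1.div_const ((n:ℝ)+2)).mul_const (Real.log r)).sub ((((hasDerivAt_pow (n+1) ρ).mul ((hasDerivAt_id ρ).mul h2))).div_const ((n:ℝ)+2))).add (h1.div_const (((n:ℝ)+2)^2))
    refine h3.congr_deriv ?_
    rw [Real.log_div hr.ne' hρ.1.ne']
    have := hρ.1.ne'
    simp
    field_simp
    ring
  have hint := intervalIntegral.integrableOn_deriv_of_nonneg hPc.continuousOn hder hnn
  rw [← ofReal_integral_eq_lintegral_ofReal (hint.mono_set Ioo_subset_Ioc_self) ((ae_restrict_iff' measurableSet_Ioo).2 (Eventually.of_forall hnn)), ← integral_Ioc_eq_integral_Ioo, ← intervalIntegral.integral_of_le hr.le,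
    intervalIntegral.integral_eq_sub_of_hasDerivAt_of_le hr.le hPc.continuousOn hder ((intervalIntegrable_iff_integrableOn_Ioc_of_le hr.le).2 hint)]
  congr 1
  simp only [hP]
  simp
  field_simp
  ring

end

section
open MeasureTheory Set Filter Topology Metric

lemma det_cm (a : ℂ) : ((ContinuousLinearMap.toSpanSingleton ℂ a).restrictScalars ℝ).det = ‖a‖ ^ 2 := by
  have h : ((ContinuousLinearMap.toSpanSingleton ℂ a).restrictScalars ℝ).det = LinearMap.det (((ContinuousLinearMap.toSpanSingleton ℂ a) : ℂ →ₗ[ℂ] ℂ).restrictScalars ℝ) := rfl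
  rw [h, LinearMap.det_restrictScalars, Algebra.norm_complex_apply, Complex.normSq_eq_norm_sq]
  congr 2
  rw [LinearMap.det_ring]; simp

lemma series_deriv (G : ℂ → ℂ) (b : ℕ → ℂ) (hG : ∀ z ∈ ball (0:ℂ) 1, HasSum (fun k => b k * z ^ (2 * k + 1)) (G z)) {z : ℂ} (hz : z ∈ ball (0:ℂ) 1) :
    DifferentiableAt ℂ G z ∧ HasSum (fun k => (2 * k + 1) * b k * z ^ (2 * k)) (deriv G z) := by
  obtain ⟨ρ, h1, h2⟩ := exists_between (mem_ball_zero_iff.1 hz)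
  have hρ : 0 < ρ := (norm_nonneg z).trans_lt h1
  have hsum : Summable fun k => ‖b k * (ρ:ℂ) ^ (2 * k + 1)‖ := ((hG ρ (by simpa [abs_of_pos hρ] using h2)).summable).norm
  have hle : ∀ (k : ℕ) (w : ℂ), w ∈ ball (0:ℂ) ρ → ‖b k * w ^ (2 * k + 1)‖ ≤ ‖b k * (ρ:ℂ) ^ (2 * k + 1)‖ := by
    intro k w hw
    rw [norm_mul, norm_mul, norm_pow, norm_pow, Complex.norm_real, Real.norm_of_nonneg hρ.le]
    have := (mem_ball_zero_iff.1 hw).le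
    gcongr
  have hz' : z ∈ ball (0:ℂ) ρ := by simpa using h1
  have hd : ∀ k : ℕ, DifferentiableOn ℂ (fun w => b k * w ^ (2 * k + 1)) (ball 0 ρ) := fun k => by fun_prop
  have heq : G =ᶠ[𝓝 z] fun w => ∑' k, b k * w ^ (2 * k + 1) := by
    filter_upwards [isOpen_ball.mem_nhds hz] with w hw using (hG w hw).tsum_eq.symm
  have A := (Complex.differentiableOn_tsum_of_summable_norm hsum hd isOpen_ball hle).differentiableAt (isOpen_ball.mem_nhds hz')
  have B := Complex.hasSum_deriv_of_summable_norm hsum hd isOpen_ball hle hz'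
  refine ⟨A.congr_of_eventuallyEq heq, ?_⟩
  rw [heq.deriv_eq]
  have e : ∀ k : ℕ, deriv (fun w : ℂ => b k * w ^ (2 * k + 1)) z = (2 * k + 1) * b k * z ^ (2 * k) := by
    intro k
    simp
    ring
  simp only [e] at B
  exact B

lemma lint_congr0 (r : ℝ) (f g : ℂ → ENNReal) (h : ∀ z, z ≠ 0 → ‖z‖ < r → f z = g z) : ∫⁻ z in ball (0:ℂ) r, f z = ∫⁻ z in ball (0:ℂ) r, g z := by
  apply setLIntegral_congr_fun_ae measurableSet_ball
  have : ∀ᵐ z : ℂ, z ≠ 0 := by simp [ae_iff]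
  filter_upwards [this] with z h0 hz
  exact h z h0 (by simpa using hz)

lemma circ_deriv (G : ℂ → ℂ) (b : ℕ → ℂ) (hG : ∀ z ∈ ball (0:ℂ) 1, HasSum (fun k => b k * z ^ (2 * k + 1)) (G z)) (ρ : ℝ) (h0 : 0 < ρ) (h1 : ρ < 1) :
    ∫⁻ θ in Ioo (-Real.pi) Real.pi, ENNReal.ofReal (‖deriv G (ρ * Complex.exp (θ * Complex.I))‖ ^ 2) = ∑' k : ℕ, ENNReal.ofReal (2 * Real.pi * (2 * k + 1) ^ 2 * ‖b k‖ ^ 2 * ρ ^ (4 * k)) := by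
  have hpi := Real.pi_pos
  have hmem : ∀ θ : ℝ, (ρ * Complex.exp (θ * Complex.I) : ℂ) ∈ ball (0:ℂ) 1 := by
    intro θ
    rw [mem_ball_zero_iff, norm_mul, Complex.norm_exp_ofReal_mul_I, Complex.norm_real, Real.norm_of_nonneg h0.le, mul_one]; exact h1
  have hρm : (ρ:ℂ) ∈ ball (0:ℂ) 1 := by simpa [abs_of_pos h0] using h1
  have hs : Summable fun k : ℕ => ‖((2 * k + 1) * b k * (ρ:ℂ) ^ (2 * k) : ℂ)‖ := (series_deriv G b hG hρm).2.summable.norm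
  have hP := parseval (fun k => (2 * k + 1) * b k * (ρ:ℂ) ^ (2 * k)) hs (fun θ => deriv G (ρ * Complex.exp (θ * Complex.I))) (fun θ => by
    have := (series_deriv G b hG (hmem θ)).2
    simpa only [mul_pow, mul_assoc] using this)
  have hcont : Continuous fun θ : ℝ => deriv G (ρ * Complex.exp (θ * Complex.I)) := by
    have hd : DifferentiableOn ℂ G (ball 0 1) := fun z hz => (series_deriv G b hG hz).1.differentiableWithinAt
    exact (hd.deriv isOpen_ball).continuousOn.comp_continuous (by fun_prop) hmem
  rw [← ofReal_integral_eq_lintegral_ofReal]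
  · rw [← integral_Ioc_eq_integral_Ioo, ← intervalIntegral.integral_of_le (by linarith), ← hP.tsum_eq, ENNReal.ofReal_tsum_of_nonneg (fun k => by positivity) hP.summable]
    congr 1; ext k; congr 1
    rw [norm_mul, norm_mul, norm_pow, Complex.norm_real, Real.norm_of_nonneg h0.le]
    have : ‖(2 * k + 1 : ℂ)‖ = 2 * k + 1 := by
      rw [show (2 * k + 1 : ℂ) = ((2 * k + 1 : ℕ) : ℂ) by push_cast; rfl, Complex.norm_natCast]; push_cast; rfl
    rw [this]; ring
  · exact ((hcont.norm.pow 2).integrableOn_Icc (a := -Real.pi) (b := Real.pi)).mono_set Ioo_subset_Icc_self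
  · exact Eventually.of_forall fun θ => by positivity

theorem area_formula (G : ℂ → ℂ) (b : ℕ → ℂ) (hG : ∀ z ∈ ball (0:ℂ) 1, HasSum (fun k => b k * z ^ (2 * k + 1)) (G z))
    (hi : InjOn G (ball 0 1)) (W : ℂ → ℝ) (r : ℝ) (h0 : 0 < r) (h1 : r < 1)
    (hin : ∀ z, z ≠ 0 → ‖z‖ < r → W (G z) = - Real.log ‖z‖) (hout : ∀ w, w ∉ G '' ball 0 r → W w ≤ - Real.log r) :
    ∫⁻ w, ENNReal.ofReal (W w - (- Real.log r)) = ∑' k : ℕ, ENNReal.ofReal (Real.pi / 2 * ‖b k‖ ^ 2 * r ^ (4 * k + 2)) := by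
  have hsub : ball (0:ℂ) r ⊆ ball 0 1 := ball_subset_ball h1.le
  have hd : DifferentiableOn ℂ G (ball 0 1) := fun z hz => (series_deriv G b hG hz).1.differentiableWithinAt
  have step1 : ∫⁻ w, ENNReal.ofReal (W w - (- Real.log r)) = ∫⁻ w in G '' ball 0 r, ENNReal.ofReal (W w - (- Real.log r)) := by
    symm
    apply setLIntegral_eq_of_support_subset
    intro w hw
    by_contra hn
    apply hw
    exact ENNReal.ofReal_of_nonpos (by linarith [hout w hn])
  have step2 := lintegral_image_eq_lintegral_abs_det_fderiv_mul volume (s := ball (0:ℂ) r) (f := G) measurableSet_ball (fun z hz => (((series_deriv G b hG (hsub hz)).1.hasDerivAt.hasFDerivAt).restrictScalars ℝ).hasFDerivWithinAt) (hi.mono hsub) (fun w => ENNReal.ofReal (W w - (- Real.log r)))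
  rw [step1, step2, lint_congr0 r _ (fun z => ENNReal.ofReal (‖deriv G z‖ ^ 2) * ENNReal.ofReal (Real.log (r / ‖z‖))) (by
    intro z hz hzr
    rw [det_cm, abs_of_nonneg (by positivity), hin z hz hzr, Real.log_div h0.ne' (norm_ne_zero_iff.2 hz)]
    congr 2; ring), ← lintegral_indicator measurableSet_ball, polar_lint _ (Measurable.indicator (by
      have := measurable_deriv G
      fun_prop) measurableSet_ball)]
  have step3 : ∀ ρ ∈ Ioi (0:ℝ), ENNReal.ofReal ρ * ∫⁻ θ in Ioo (-Real.pi) Real.pi, (ball (0:ℂ) r).indicator (fun z => ENNReal.ofReal (‖deriv G z‖ ^ 2) * ENNReal.ofReal (Real.log (r / ‖z‖))) (ρ * Complex.exp (θ * Complex.I)) =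
      (Iio r).indicator (fun ρ => ∑' k : ℕ, ENNReal.ofReal (2 * Real.pi * (2 * k + 1) ^ 2 * ‖b k‖ ^ 2) * ENNReal.ofReal (ρ ^ (4 * k + 1) * Real.log (r / ρ))) ρ := by
    intro ρ hρ
    have hρ : 0 < ρ := hρ
    have hn : ∀ θ : ℝ, ‖(ρ * Complex.exp (θ * Complex.I) : ℂ)‖ = ρ := by
      intro θ; rw [norm_mul, Complex.norm_exp_ofReal_mul_I, Complex.norm_real, Real.norm_of_nonneg hρ.le, mul_one]
    by_cases hr : ρ < r
    · rw [indicator_of_mem (show ρ ∈ Iio r from hr)]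
      have : ∀ θ : ℝ, (ball (0:ℂ) r).indicator (fun z => ENNReal.ofReal (‖deriv G z‖ ^ 2) * ENNReal.ofReal (Real.log (r / ‖z‖))) (ρ * Complex.exp (θ * Complex.I)) = ENNReal.ofReal (‖deriv G (ρ * Complex.exp (θ * Complex.I))‖ ^ 2) * ENNReal.ofReal (Real.log (r / ρ)) := by
        intro θ
        rw [indicator_of_mem (by rw [mem_ball_zero_iff, hn]; exact hr), hn]
      simp_rw [this]
      have hlog : 0 ≤ Real.log (r / ρ) := Real.log_nonneg (by rw [le_div_iff₀ hρ]; linarith)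
      rw [lintegral_mul_const' _ _ ENNReal.ofReal_ne_top, circ_deriv G b hG ρ hρ (hr.trans h1), mul_left_comm, ← ENNReal.ofReal_mul hρ.le, ← ENNReal.tsum_mul_right]
      congr 1; ext k
      rw [← ENNReal.ofReal_mul (by positivity), ← ENNReal.ofReal_mul (by positivity)]
      congr 1; ring
    · rw [indicator_of_notMem (show ρ ∉ Iio r from hr)]
      have : ∀ θ : ℝ, (ball (0:ℂ) r).indicator (fun z => ENNReal.ofReal (‖deriv G z‖ ^ 2) * ENNReal.ofReal (Real.log (r / ‖z‖))) (ρ * Complex.exp (θ * Complex.I)) = 0 := by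
        intro θ
        rw [indicator_of_notMem (by rw [mem_ball_zero_iff, hn]; exact hr)]
      simp_rw [this]; simp
  rw [setLIntegral_congr_fun measurableSet_Ioi step3, setLIntegral_indicator measurableSet_Iio, show Iio r ∩ Ioi 0 = Ioo 0 r by ext; simp [and_comm], lintegral_tsum (fun k => by fun_prop)]
  congr 1; ext k
  rw [lintegral_const_mul _ (by fun_prop)]
  have := int_rlog (4 * k) r h0
  rw [this, ← ENNReal.ofReal_mul (by positivity)]
  congr 1
  push_cast
  field_simp
  ring

end

section
open MeasureTheory Set Filter Topology Metric

lemma odd_geom {x : ℝ} (h0 : 0 ≤ x) (h1 : x < 1) : HasSum (fun k : ℕ => x ^ (2 * k + 1)) (x / (1 - x ^ 2)) := by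
  have := (hasSum_geometric_of_lt_one (r := x ^ 2) (by positivity) (by nlinarith)).mul_left x
  convert! this using 1
  ext k; rw [pow_succ, pow_mul, mul_comm]

lemma odd_geomC {z : ℂ} (hz : z ∈ ball (0:ℂ) 1) : HasSum (fun k : ℕ => z ^ (2 * k + 1)) (z / (1 - z ^ 2)) := by
  have hn := mem_ball_zero_iff.1 hz
  have := (hasSum_geometric_of_norm_lt_one (ξ := z ^ 2) (by rw [norm_pow]; nlinarith [norm_nonneg z])).mul_left z
  convert! this using 1
  ext k; rw [pow_succ, pow_mul, mul_comm]

lemma nice_coeff {F : ℂ → ℂ} {R1 : ℝ} (H : NiceF F R1) (b : ℕ → ℂ) (hG : ∀ z ∈ ball (0:ℂ) 1, HasSum (fun k => b k * z ^ (2 * k + 1)) (F z))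
    (r : ℝ) (h0 : 0 < r) (h1 : r < 1) (N : ℕ) : ∑ k ∈ Finset.range N, ‖b k‖ ^ 2 * (r ^ 2) ^ (2 * k + 1) ≤ r ^ 2 / (1 - (r ^ 2) ^ 2) := by
  have hl : 0 ≤ - Real.log r := by linarith [Real.log_nonpos h0.le h1.le]
  have hsub : ball (0:ℂ) 1 ⊆ ball 0 R1 := ball_subset_ball H.hR.le
  have key := area_comparison H (- Real.log r) hl
  rw [area_formula F b hG (H.hi.mono hsub) (UU F R1) r h0 h1 (by
      intro z hz hzr
      rw [H.UF (hsub (by simpa using hzr.trans h1)), max_eq_right]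
      linarith [Real.log_nonpos (norm_nonneg z) (hzr.trans h1).le]) (by
      intro w hw
      rw [UU]
      split_ifs with h
      · refine max_le hl (neg_le_neg (Real.log_le_log h0 ?_))
        by_contra hn
        exact hw ⟨_, by simpa using hn, H.Fg h⟩
      · exact hl),
    area_formula KK (fun _ => 1) (fun z hz => by simpa [KK] using odd_geomC hz) K_inj VV r h0 h1 (by
      intro z hz hzr
      have hz1 := hzr.trans h1
      refine VK hz hz1.le ?_
      intro h
      exact one_sub_sq_ne (z := z) (by simpa using hz1) (by rw [h]; ring)) (by
      intro w hw
      have hw0 : w ≠ 0 := by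
        rintro rfl; exact hw ⟨0, by simpa using h0, by simp [KK]⟩
      obtain ⟨z, g0, g1, g2, g3⟩ := K_surj hw0
      rw [← g3, VK g0 g1 g2]
      refine neg_le_neg (Real.log_le_log h0 ?_)
      by_contra hn
      exact hw ⟨z, by simpa using hn, g3⟩)] at key
  have hx : r ^ 2 < 1 := by nlinarith
  have hg := (odd_geom (x := r ^ 2) (by positivity) hx).mul_left (Real.pi / 2)
  have e : ∀ k : ℕ, Real.pi / 2 * ‖(1:ℂ)‖ ^ 2 * r ^ (4 * k + 2) = Real.pi / 2 * (r ^ 2) ^ (2 * k + 1) := by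
    intro k; rw [norm_one]; ring
  simp only [e] at key
  rw [← ENNReal.ofReal_tsum_of_nonneg (fun k => by positivity) hg.summable, hg.tsum_eq] at key
  have k2 := (ENNReal.sum_le_tsum (Finset.range N)).trans key
  rw [← ENNReal.ofReal_sum_of_nonneg (fun k _ => by positivity), ENNReal.ofReal_le_ofReal_iff (by
    have : 0 < 1 - (r ^ 2) ^ 2 := by nlinarith
    positivity)] at k2
  have e2 : ∀ k : ℕ, Real.pi / 2 * ‖b k‖ ^ 2 * r ^ (4 * k + 2) = Real.pi / 2 * (‖b k‖ ^ 2 * (r ^ 2) ^ (2 * k + 1)) := by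
    intro k; ring
  simp only [e2] at k2
  rw [← Finset.mul_sum] at k2
  exact le_of_mul_le_mul_left k2 (by positivity)

lemma coeff_bound (f : ℂ → ℂ) (a : ℕ → ℂ) (hf : ∀ z ∈ ball (0:ℂ) 1, HasSum (fun k => a k * z ^ (2 * k + 1)) (f z))
    (hu : InjOn f (ball 0 1)) (ha : a 0 ≠ 0) (x : ℝ) (h0 : 0 < x) (h1 : x < 1) (N : ℕ) :
    ∑ k ∈ Finset.range N, ‖a k‖ ^ 2 * x ^ (2 * k + 1) ≤ ‖a 0‖ ^ 2 * (x / (1 - x ^ 2)) := by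
  have hα : 0 < ‖a 0‖ := norm_pos_iff.2 ha
  have main : ∀ q ∈ Ioo (0:ℝ) 1, ∑ k ∈ Finset.range N, ‖a k‖ ^ 2 * q ^ (4 * k) * x ^ (2 * k + 1) ≤ ‖a 0‖ ^ 2 * (x / (1 - x ^ 2)) := by
    intro q hq
    have hq0 : (q:ℂ) ≠ 0 := by exact_mod_cast hq.1.ne'
    have hnq : ‖(q:ℂ)‖ = q := by rw [Complex.norm_real, Real.norm_of_nonneg hq.1.le]
    have hm : ∀ z ∈ ball (0:ℂ) (1 / q), (q:ℂ) * z ∈ ball (0:ℂ) 1 := by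
      intro z hz
      rw [mem_ball_zero_iff] at hz ⊢
      rw [norm_mul, hnq]
      rw [lt_div_iff₀ hq.1] at hz; linarith
    have h1q : 1 < 1 / q := by rw [lt_div_iff₀ hq.1]; linarith [hq.2]
    have hsub : ball (0:ℂ) 1 ⊆ ball 0 (1 / q) := ball_subset_ball h1q.le
    have hser : ∀ z ∈ ball (0:ℂ) (1 / q), HasSum (fun k => (a k * q ^ (2 * k) / a 0) * z ^ (2 * k + 1)) (f (q * z) / (q * a 0)) := by
      intro z hz
      have := (hf _ (hm z hz)).div_const (q * a 0)
      convert! this using 1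
      ext k; field_simp
      ring
    have hdf : ∀ z ∈ ball (0:ℂ) 1, DifferentiableAt ℂ f z := fun z hz => (series_deriv f a hf hz).1
    have H : NiceF (fun z => f (q * z) / (q * a 0)) (1 / q) :=
      { hR := h1q
        hd := by
          intro z hz
          have : DifferentiableAt ℂ (fun z => f (q * z)) z := DifferentiableAt.comp z (hdf _ (hm z hz)) (by fun_prop)
          exact (this.div_const _).differentiableWithinAt
        hi := by
          intro z hz w hw h
          have h' : f (q * z) = f (q * w) := by
            have := h; simp only at this
            rwa [div_left_inj' (mul_ne_zero hq0 ha)] at this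
          exact mul_left_cancel₀ hq0 (hu (hm z hz) (hm w hw) h')
        hodd := by
          intro z hz
          have e1 := hser (-z) (by simpa using hz)
          have e2 := (hser z hz).neg
          refine e1.unique ?_
          convert! e2 using 1
          ext k
          rw [Odd.neg_pow ⟨k, rfl⟩]; ring
        hder := by
          have hs := (series_deriv (fun z => f (q * z) / (q * a 0)) (fun k => a k * q ^ (2 * k) / a 0) (fun z hz => hser z (hsub hz)) (mem_ball_self one_pos)).2
          have := hs.tsum_eq
          rw [← this, tsum_eq_single 0 (by intro k hk; simp [hk])]
          simp [ha] }
    have hsq : 0 < √x := Real.sqrt_pos.2 h0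
    have := nice_coeff H (fun k => a k * q ^ (2 * k) / a 0) (fun z hz => hser z (hsub hz)) (√x) hsq (by rw [Real.sqrt_lt' one_pos]; simpa using h1) N
    rw [Real.sq_sqrt h0.le] at this
    have h3 := mul_le_mul_of_nonneg_left this (sq_nonneg ‖a 0‖)
    rw [Finset.mul_sum] at h3
    convert! h3 using 2 with k
    rw [norm_div, norm_mul, norm_pow, hnq]
    field_simp
    ring
  have hc : Continuous fun q : ℝ => ∑ k ∈ Finset.range N, ‖a k‖ ^ 2 * q ^ (4 * k) * x ^ (2 * k + 1) := by fun_prop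
  have ht : Tendsto (fun q : ℝ => ∑ k ∈ Finset.range N, ‖a k‖ ^ 2 * q ^ (4 * k) * x ^ (2 * k + 1)) (𝓝[<] 1) (𝓝 (∑ k ∈ Finset.range N, ‖a k‖ ^ 2 * (1:ℝ) ^ (4 * k) * x ^ (2 * k + 1))) :=
    (hc.tendsto 1).mono_left nhdsWithin_le_nhds
  have := le_of_tendsto ht (by
    filter_upwards [Ioo_mem_nhdsLT (show (0:ℝ) < 1 by norm_num)] with q hq using main q hq)
  simpa using this


end

/-- If `f(z) = ∑_{k≥0} a_{2k+1} z^{2k+1}` is odd, analytic and univalent in 𝔻 with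
`0 < α = |a_1| ≤ 1`, then `∑_{k≥0} |a_{2k+1}| r^{2k+1} ≤ 1` for all
`0 ≤ r ≤ r_α = (-α + √(4+α²))/2`; the bound is attained by the extremal function
`α z/(1-z²)`, whose majorant series at `r_α` equals `1`. -/
theorem bohr_odd_univalent_unnormalized (f : ℂ → ℂ) (a : ℕ → ℂ)
    (hf : ∀ z ∈ Metric.ball (0 : ℂ) 1, HasSum (fun k : ℕ => a k * z ^ (2 * k + 1)) (f z))
    (huniv : Set.InjOn f (Metric.ball (0 : ℂ) 1))
    (α : ℝ) (hα : α = ‖a 0‖) (hα0 : 0 < α) (hα1 : α ≤ 1)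
    (rα : ℝ) (hrα : rα = (-α + Real.sqrt (4 + α ^ 2)) / 2) :
    (∀ r : ℝ, 0 ≤ r → r ≤ rα → ∑' k : ℕ, ‖a k‖ * r ^ (2 * k + 1) ≤ 1) ∧
    -- sharpness: the function `α z/(1-z²)`, with odd coefficients all equal to `α`,
    -- has majorant series exactly `1` at `r = r_α`
    (∀ z ∈ Metric.ball (0 : ℂ) 1,
      HasSum (fun k : ℕ => (α : ℂ) * z ^ (2 * k + 1)) ((α : ℂ) * z / (1 - z ^ 2))) ∧
    ∑' k : ℕ, ‖(α : ℂ)‖ * rα ^ (2 * k + 1) = 1 := by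
  have hsq : √(4 + α ^ 2) ^ 2 = 4 + α ^ 2 := Real.sq_sqrt (by positivity)
  have hroot : rα ^ 2 + α * rα = 1 := by rw [hrα]; linear_combination hsq / 4
  have hpos : 0 < rα := by
    have : α < √(4 + α ^ 2) := Real.lt_sqrt_of_sq_lt (by linarith)
    rw [hrα]; linarith
  have hlt : rα < 1 := by nlinarith [mul_pos hα0 hpos]
  refine ⟨?_, ?_, ?_⟩
  · intro r h0 hr
    rcases h0.eq_or_lt with rfl | h0
    · simp
    have hr1 : r < 1 := hr.trans_lt hlt
    have hg := odd_geom h0.le hr1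
    have hden : 0 < 1 - r ^ 2 := by nlinarith
    have hle : α * (r / (1 - r ^ 2)) ≤ 1 := by
      rw [← mul_div_assoc, div_le_one hden]
      nlinarith
    apply Real.tsum_le_of_sum_range_le (fun k => by positivity)
    intro N
    have hcs := Finset.sum_mul_sq_le_sq_mul_sq (Finset.range N) (fun k => ‖a k‖ * √(r ^ (2 * k + 1))) (fun k => √(r ^ (2 * k + 1)))
    have e1 : ∀ k : ℕ, ‖a k‖ * √(r ^ (2 * k + 1)) * √(r ^ (2 * k + 1)) = ‖a k‖ * r ^ (2 * k + 1) := by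
      intro k; rw [mul_assoc, Real.mul_self_sqrt (by positivity)]
    have e2 : ∀ k : ℕ, (‖a k‖ * √(r ^ (2 * k + 1))) ^ 2 = ‖a k‖ ^ 2 * r ^ (2 * k + 1) := by
      intro k; rw [mul_pow, Real.sq_sqrt (by positivity)]
    have e3 : ∀ k : ℕ, √(r ^ (2 * k + 1)) ^ 2 = r ^ (2 * k + 1) := by
      intro k; rw [Real.sq_sqrt (by positivity)]
    simp only [e1, e2, e3] at hcs
    have b1 := coeff_bound f a hf huniv (by intro h; rw [h, norm_zero] at hα; linarith) r h0 hr1 N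
    rw [← hα] at b1
    have b2 : ∑ k ∈ Finset.range N, r ^ (2 * k + 1) ≤ r / (1 - r ^ 2) := by
      rw [← hg.tsum_eq]; exact hg.summable.sum_le_tsum _ (fun k _ => by positivity)
    have hG : 0 < r / (1 - r ^ 2) := by positivity
    have b3 : (∑ k ∈ Finset.range N, ‖a k‖ * r ^ (2 * k + 1)) ^ 2 ≤ (α * (r / (1 - r ^ 2))) ^ 2 := by
      refine hcs.trans ((mul_le_mul b1 b2 (Finset.sum_nonneg fun k _ => by positivity) (by positivity)).trans_eq (by ring))
    exact (abs_le_of_sq_le_sq' b3 (by positivity)).2.trans hle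
  · intro z hz
    rw [mul_div_assoc]
    exact (odd_geomC hz).mul_left _
  · have hg := (odd_geom hpos.le hlt).mul_left ‖(α:ℂ)‖
    rw [hg.tsum_eq, Complex.norm_real, Real.norm_of_nonneg hα0.le, ← mul_div_assoc, div_eq_one_iff_eq (by nlinarith)]
    linarith
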